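/- Let N ≥ 1, α > 0, and let 1 ≤ σ < 4/(N−2) (interpreted as σ ≥ 1 arbitrary when N ≤ 2). Then there exists an exponent r with 2 < r ≤ 2N/(N−2) (interpreted as 2 < r < ∞ when N ≤ 2) satisfying N/r − N/2 + 1 > 0, and a constant C_α > 0 depending only on N, σ, α, with the following property. Let J = [a, b] ⊂ ℝ be a compact interval, let M > 0, and for j = 1, 2 let v_j : J → (Schwartz functions ℝ^N → ℂ) be continuous curves with ‖v_j(τ)‖_{H¹} ≤ M for all τ ∈ J; for each τ ∈ J let u_j(τ) be the Schwartz function satisfying u_j(τ) − α²Δu_j(τ) = |v_j(τ)|^{σ+1} on ℝ^N, and set f(v_j(τ)) = u_j(τ) |v_j(τ)|^{σ−1} v_j(τ). Then for all t₁ ≤ t₂ in J and all t ∈ [t₁, t₂], ‖∫_{t₁}^{t₂} U(t−τ) [ f(v₁(τ)) − f(v₂(τ)) ] dτ‖_{L^r} ≤ (4π)^{N/r − N/2} C_α (2M)^{2σ} (sup_{τ∈J} ‖v₁(τ) − v₂(τ)‖_{L^r}) (t₂ − t₁)^{N/r − N/2 + 1}, where 1/r + 1/r' = 1. -/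

import Mathlib

open MeasureTheory Real Set
open scoped ENNReal NNReal ComplexConjugate

noncomputable section

/-- Standard basis vector of `ℝ^N`. -/
def basisVec (N : ℕ) (i : Fin N) : EuclideanSpace ℝ (Fin N) :=
  EuclideanSpace.single i 1

/-- The Laplacian of a function on `ℝ^N`. -/
def lap {E : Type*} [NormedAddCommGroup E] [NormedSpace ℝ E]
    (N : ℕ) (u : EuclideanSpace ℝ (Fin N) → E) (x : EuclideanSpace ℝ (Fin N)) : E :=
  ∑ i : Fin N, fderiv ℝ (fun y => fderiv ℝ u y (basisVec N i)) x (basisVec N i)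

/-- The `L^p` norm (with real exponent `p`) of a function on `ℝ^N`. -/
def LpN (N : ℕ) {E : Type*} [NormedAddCommGroup E]
    (f : EuclideanSpace ℝ (Fin N) → E) (p : ℝ) : ℝ :=
  (eLpNorm f (ENNReal.ofReal p) volume).toReal

/-- The `L²` norm of the (total) derivative of a function on `ℝ^N`. -/
def gradL2 (N : ℕ) (v : EuclideanSpace ℝ (Fin N) → ℂ) : ℝ :=
  (eLpNorm (fun x => fderiv ℝ v x) 2 volume).toReal

/-- The `H¹` norm of a function on `ℝ^N`. -/
def H1norm (N : ℕ) (v : EuclideanSpace ℝ (Fin N) → ℂ) : ℝ :=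
  Real.sqrt ((LpN N v 2) ^ 2 + (gradL2 N v) ^ 2)

/-- The free Schrödinger propagator `U(s) = exp(isΔ)`, given for `s ≠ 0` by the
oscillatory integral kernel `(U(s)φ)(x) = (4πis)^{-N/2} ∫ e^{i|x-y|²/(4s)} φ(y) dy`
(principal branch), and by the identity for `s = 0`. -/
def schrodingerProp (N : ℕ) (t : ℝ) (φ : EuclideanSpace ℝ (Fin N) → ℂ)
    (x : EuclideanSpace ℝ (Fin N)) : ℂ :=
  if t = 0 then φ x else
    (4 * (Real.pi : ℂ) * Complex.I * (t : ℂ)) ^ (-(N : ℂ) / 2) *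
      ∫ y, Complex.exp (Complex.I * ((‖x - y‖ ^ 2 / (4 * t) : ℝ) : ℂ)) * φ y

section

open FourierTransform SchwartzMap

lemma eLpNorm_fourier_two {N : ℕ} {f : EuclideanSpace ℝ (Fin N) → ℂ} (hf : Integrable f)
    (hf2 : MemLp f 2) : eLpNorm (𝓕 f) 2 volume = eLpNorm f 2 volume := by
  have hcont : Continuous (𝓕 f) :=
    VectorFourier.fourierIntegral_continuous Real.continuous_fourierChar
      (by exact continuous_inner) hf
  have key : ∀ᵐ x, (𝓕 (hf2.toLp f) : Lp ℂ 2 (volume : Measure (EuclideanSpace ℝ (Fin N)))) x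
      = 𝓕 f x := by
    refine ae_eq_of_integral_contDiff_smul_eq
      ((Lp.memLp _).locallyIntegrable (by norm_num)) hcont.locallyIntegrable ?_
    intro g hg hgc
    have hg' : ContDiff ℝ (⊤ : ℕ∞) (fun x => (g x : ℂ)) := Complex.ofRealCLM.contDiff.comp hg
    have hgc' : HasCompactSupport (fun x => (g x : ℂ)) :=
      hgc.comp_left (g := Complex.ofReal) Complex.ofReal_zero
    let G : SchwartzMap (EuclideanSpace ℝ (Fin N)) ℂ := hgc'.toSchwartzMap hg'
    have h1 := DFunLike.congr_fun (Lp.fourier_toTemperedDistribution_eq (hf2.toLp f)) G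
    simp only [TemperedDistribution.fourier_apply, Lp.toTemperedDistribution_apply] at h1
    have h2 : ∫ x, (𝓕 G) x • (hf2.toLp f) x = ∫ x, (𝓕 G) x • f x :=
      integral_congr_ae (by filter_upwards [hf2.coeFn_toLp] with x hx; rw [hx])
    have h3 : ∫ x, (𝓕 G) x • f x = ∫ x, G x • 𝓕 f x := by
      have := VectorFourier.integral_bilin_fourierIntegral_eq_flip (μ := volume) (ν := volume)
        (L := innerₗ (EuclideanSpace ℝ (Fin N))) (ContinuousLinearMap.mul ℂ ℂ)
        Real.continuous_fourierChar (by exact continuous_inner) G.integrable hf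
      simpa [flip_innerₗ] using! this
    rw [h2, h3] at h1
    simpa [G] using! h1.symm
  rw [← eLpNorm_congr_ae key, ← eLpNorm_congr_ae hf2.coeFn_toLp]
  have := Lp.norm_fourier_eq (hf2.toLp f)
  rw [Lp.norm_def, Lp.norm_def] at this
  exact (ENNReal.toReal_eq_toReal_iff' (Lp.eLpNorm_ne_top _) (Lp.eLpNorm_ne_top _)).1 this

lemma eLpNorm_fourier_two_le {N : ℕ} {f : EuclideanSpace ℝ (Fin N) → ℂ} (hf : Integrable f) :
    eLpNorm (𝓕 f) 2 volume ≤ eLpNorm f 2 volume := by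
  by_cases h : eLpNorm f 2 volume = ⊤
  · simp [h]
  · exact (eLpNorm_fourier_two hf ⟨hf.1, lt_top_iff_ne_top.2 h⟩).le

lemma norm_fourier_le_integral_norm {N : ℕ} (f : EuclideanSpace ℝ (Fin N) → ℂ)
    (x : EuclideanSpace ℝ (Fin N)) : ‖𝓕 f x‖ ≤ ∫ y, ‖f y‖ :=
  VectorFourier.norm_fourierIntegral_le_integral_norm _ _ _ f x

/-- Distribution function estimate for the Fourier transform. -/
lemma meas_lt_norm_fourier_le {N : ℕ} {f : EuclideanSpace ℝ (Fin N) → ℂ} (hf : Integrable f)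
    (hfm : Measurable f) {p A : ℝ} (hA : 0 < A) (hfp : Integrable fun y => ‖f y‖ ^ p)
    (hp : 1 < p)
    (hfA : ∫ y, ‖f y‖ ^ p = A) {t : ℝ} (ht : 0 < t) :
    volume {x | t < ‖𝓕 f x‖} ≤ ENNReal.ofReal (4 / t ^ 2) *
      ∫⁻ y, {y | ‖f y‖ ^ (p - 1) * t ≤ 2 * A}.indicator (fun y => ‖f y‖ₑ ^ (2 : ℝ)) y := by
  set S : Set (EuclideanSpace ℝ (Fin N)) := {y | ‖f y‖ ^ (p - 1) * t ≤ 2 * A} with hS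
  have hSm : MeasurableSet S :=
    measurableSet_le ((hfm.norm.pow_const _).mul_const _) measurable_const
  have hs : Integrable (S.indicator f) := hf.indicator hSm
  have hb : Integrable (Sᶜ.indicator f) := hf.indicator hSm.compl
  have hbig : ∫ y, ‖Sᶜ.indicator f y‖ ≤ t / 2 := by
    have h1 : ∫ y, ‖Sᶜ.indicator f y‖ ≤ ∫ y, t / (2 * A) * ‖f y‖ ^ p := by
      refine integral_mono hb.norm (hfp.const_mul _) fun y => ?_
      by_cases hy : y ∈ S
      · simp only [indicator_compl, Pi.sub_apply, indicator_of_mem hy, sub_self, norm_zero]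
        positivity
      · rw [indicator_of_mem (by exact hy)]
        have hy' : 2 * A < ‖f y‖ ^ (p - 1) * t := by simpa [hS] using hy
        have h0 : 0 < ‖f y‖ := by
          rcases (norm_nonneg (f y)).eq_or_lt with h | h
          · rw [← h, Real.zero_rpow (by linarith), zero_mul] at hy'
            linarith
          · exact h
        have : ‖f y‖ ^ p = ‖f y‖ ^ (p - 1) * ‖f y‖ := by
          rw [← Real.rpow_add_one h0.ne']; ring_nf
        rw [this, div_mul_eq_mul_div, le_div_iff₀ (by positivity)]
        nlinarith
    rw [integral_const_mul, hfA] at h1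
    calc _ ≤ _ := h1
      _ = t / 2 := by field_simp
  have hsplit : ∀ x, 𝓕 f x = 𝓕 (S.indicator f) x + 𝓕 (Sᶜ.indicator f) x := by
    intro x
    have h := VectorFourier.fourierIntegral_add (μ := volume)
      (L := innerₗ (EuclideanSpace ℝ (Fin N))) Real.continuous_fourierChar
      (by exact continuous_inner) hs hb
    have h' := congrFun h x
    rw [indicator_self_add_compl, Pi.add_apply] at h'
    simpa only [Real.fourier_eq, VectorFourier.fourierIntegral, innerₗ_apply_apply] using h'
  have hsub : {x | t < ‖𝓕 f x‖} ⊆ {x | ENNReal.ofReal (t / 2) ≤ ‖𝓕 (S.indicator f) x‖ₑ} := by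
    intro x hx
    simp only [mem_ofPred_eq] at hx ⊢
    rw [← ofReal_norm]
    apply ENNReal.ofReal_le_ofReal
    have h1 := norm_add_le (𝓕 (S.indicator f) x) (𝓕 (Sᶜ.indicator f) x)
    rw [← hsplit] at h1
    have h2 := (norm_fourier_le_integral_norm (Sᶜ.indicator f) x).trans hbig
    linarith
  have hcont : Continuous (𝓕 (S.indicator f)) :=
    VectorFourier.fourierIntegral_continuous Real.continuous_fourierChar
      (by exact continuous_inner) hs
  have hne : ENNReal.ofReal (t / 2) ≠ 0 := by simpa using ht
  have hcheb := meas_ge_le_mul_pow_eLpNorm_enorm (p := 2) (ε := ENNReal.ofReal (t / 2)) volume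
    (by norm_num) (by norm_num) hcont.aestronglyMeasurable hne (by simp)
  calc _ ≤ _ := measure_mono hsub
    _ ≤ _ := hcheb
    _ ≤ (ENNReal.ofReal (t / 2))⁻¹ ^ (2 : ℝ≥0∞).toReal *
        eLpNorm (S.indicator f) 2 volume ^ (2 : ℝ≥0∞).toReal := by
      gcongr
      exact eLpNorm_fourier_two_le hs
    _ = _ := by
      congr 1
      · rw [← ENNReal.ofReal_inv_of_pos (by positivity),
          ENNReal.ofReal_rpow_of_nonneg (by positivity) (by positivity)]
        congr 1
        simp
        field_simp
        norm_num
      · rw [eLpNorm_eq_lintegral_rpow_enorm_toReal (by norm_num) (by norm_num),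
          ← ENNReal.rpow_mul]
        simp only [ENNReal.toReal_ofNat, one_div, isUnit_iff_ne_zero, ne_eq, OfNat.ofNat_ne_zero,
          not_false_eq_true, IsUnit.inv_mul_cancel, ENNReal.rpow_one]
        congr 1 with y
        by_cases hy : y ∈ S <;> simp [hy]

/-- **Hausdorff–Young inequality**, up to a constant, for measurable integrable functions. -/
lemma lintegral_fourier_rpow_le {N : ℕ} {f : EuclideanSpace ℝ (Fin N) → ℂ} (hf : Integrable f)
    (hfm : Measurable f) {p q A : ℝ} (hA : 0 < A) (hfp : Integrable fun y => ‖f y‖ ^ p)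
    (hq : 2 < q) (hpq : p = q / (q - 1)) (hfA : ∫ y, ‖f y‖ ^ p = A) :
    ∫⁻ x, ‖𝓕 f x‖ₑ ^ q ≤ ENNReal.ofReal (4 * q * 2 ^ (q - 2) / (q - 2) * A ^ (q - 1)) := by
  have hq1 : 0 < q - 1 := by linarith
  have hq2 : 0 < q - 2 := by linarith
  have hp1 : p - 1 = 1 / (q - 1) := by rw [hpq]; field_simp; ring
  have hp : 1 < p := by
    have : 0 < 1 / (q - 1) := by positivity
    linarith
  have hcont : Continuous (𝓕 f) :=
    VectorFourier.fourierIntegral_continuous Real.continuous_fourierChar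
      (by exact continuous_inner) hf
  have h0 : ∫⁻ x, ‖𝓕 f x‖ₑ ^ q = ∫⁻ x, ENNReal.ofReal (‖𝓕 f x‖ ^ q) := by
    congr 1 with x
    rw [← ofReal_norm, ENNReal.ofReal_rpow_of_nonneg (norm_nonneg _) (by linarith)]
  rw [h0, lintegral_rpow_eq_lintegral_meas_lt_mul volume (ae_of_all _ fun x => norm_nonneg _)
    hcont.norm.aemeasurable (by linarith)]
  have hslice : ∀ y, ∫⁻ t in Ioi (0 : ℝ), ENNReal.ofReal (4 * t ^ (q - 3)) *
      {y | ‖f y‖ ^ (p - 1) * t ≤ 2 * A}.indicator (fun y => ‖f y‖ₑ ^ (2 : ℝ)) y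
      ≤ ENNReal.ofReal (4 * (2 * A) ^ (q - 2) / (q - 2) * ‖f y‖ ^ p) := by
    intro y
    rcases (norm_nonneg (f y)).eq_or_lt with h | h
    · have hy : f y = 0 := norm_eq_zero.1 h.symm
      simp [indicator, hy]
    set T := 2 * A / ‖f y‖ ^ (p - 1) with hT
    have hT0 : 0 < T := by positivity
    have h1 : ∀ t ∈ Ioi (0 : ℝ), ENNReal.ofReal (4 * t ^ (q - 3)) *
      {y | ‖f y‖ ^ (p - 1) * t ≤ 2 * A}.indicator (fun y => ‖f y‖ₑ ^ (2 : ℝ)) y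
      = (Iic T).indicator (fun t => ENNReal.ofReal (4 * t ^ (q - 3) * ‖f y‖ ^ 2)) t := by
      intro t ht
      have ht0 : 0 < t := ht
      have hiff : y ∈ {y | ‖f y‖ ^ (p - 1) * t ≤ 2 * A} ↔ t ∈ Iic T := by
        simp only [mem_ofPred_eq, mem_Iic, hT]
        rw [le_div_iff₀ (by positivity), mul_comm]
      by_cases hy : t ∈ Iic T
      · rw [indicator_of_mem hy, indicator_of_mem (hiff.2 hy),
          ENNReal.ofReal_mul (p := 4 * t ^ (q - 3)) (by positivity), ← ofReal_norm,
          ENNReal.ofReal_rpow_of_nonneg (norm_nonneg _) (by norm_num), Real.rpow_two]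
      · rw [indicator_of_notMem hy, indicator_of_notMem (fun h => hy (hiff.1 h)), mul_zero]
    rw [setLIntegral_congr_fun measurableSet_Ioi h1, setLIntegral_indicator measurableSet_Iic,
      inter_comm, Ioi_inter_Iic]
    have h_int : IntervalIntegrable (fun t : ℝ => t ^ (q - 3)) volume 0 T :=
      intervalIntegral.intervalIntegrable_rpow' (by linarith)
    have h_int' : IntegrableOn (fun t : ℝ => 4 * t ^ (q - 3) * ‖f y‖ ^ 2) (Ioc 0 T) := by
      exact (((intervalIntegrable_iff_integrableOn_Ioc_of_le hT0.le).1 h_int).const_mul 4).mul_const _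
    rw [← ofReal_integral_eq_lintegral_ofReal h_int' (by
      filter_upwards [ae_restrict_mem measurableSet_Ioc] with t ht
      have := ht.1
      simp only [Pi.zero_apply]
      positivity)]
    apply ENNReal.ofReal_le_ofReal
    rw [integral_mul_const, integral_const_mul, ← intervalIntegral.integral_of_le hT0.le,
      integral_rpow (Or.inl (by linarith)), Real.zero_rpow (by linarith), sub_zero,
      show q - 3 + 1 = q - 2 by ring, hT, Real.div_rpow (by positivity) (by positivity),
      ← Real.rpow_mul h.le]
    have h2 : ‖f y‖ ^ p = ‖f y‖ ^ 2 / ‖f y‖ ^ ((p - 1) * (q - 2)) := by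
      rw [← Real.rpow_natCast, ← Real.rpow_sub h]
      congr 1
      rw [hp1, hpq]
      field_simp
      push_cast
      ring
    rw [h2]
    apply le_of_eq
    ring
  have hmeas : Measurable fun z : ℝ × EuclideanSpace ℝ (Fin N) =>
      ENNReal.ofReal (4 * z.1 ^ (q - 3)) *
      {y | ‖f y‖ ^ (p - 1) * z.1 ≤ 2 * A}.indicator (fun y => ‖f y‖ₑ ^ (2 : ℝ)) z.2 := by
    have h1 : MeasurableSet {z : ℝ × EuclideanSpace ℝ (Fin N) |
        ‖f z.2‖ ^ (p - 1) * z.1 ≤ 2 * A} :=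
      measurableSet_le (((hfm.comp measurable_snd).norm.pow_const _).mul measurable_fst)
        measurable_const
    have h2 : Measurable fun z : ℝ × EuclideanSpace ℝ (Fin N) => ‖f z.2‖ₑ ^ (2 : ℝ) :=
      (hfm.comp measurable_snd).enorm.pow_const _
    exact (by fun_prop : Measurable fun z : ℝ × EuclideanSpace ℝ (Fin N) =>
      ENNReal.ofReal (4 * z.1 ^ (q - 3))).mul (h2.indicator h1)
  calc _ ≤ ENNReal.ofReal q * ∫⁻ t in Ioi (0 : ℝ), ∫⁻ y, ENNReal.ofReal (4 * t ^ (q - 3)) *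
      {y | ‖f y‖ ^ (p - 1) * t ≤ 2 * A}.indicator (fun y => ‖f y‖ₑ ^ (2 : ℝ)) y := by
        gcongr 1
        refine setLIntegral_mono' measurableSet_Ioi fun t ht => ?_
        have ht0 : 0 < t := ht
        rw [lintegral_const_mul' _ _ ENNReal.ofReal_ne_top]
        calc _ ≤ _ := mul_le_mul_left (meas_lt_norm_fourier_le hf hfm hA hfp hp hfA ht0) _
          _ = _ := by
            rw [mul_right_comm, ← ENNReal.ofReal_mul (by positivity)]
            congr 2
            rw [show q - 1 = q - 3 + (2 : ℕ) by push_cast; ring, Real.rpow_add ht0,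
              Real.rpow_natCast]
            field_simp
    _ = ENNReal.ofReal q * ∫⁻ y, ∫⁻ t in Ioi (0 : ℝ), ENNReal.ofReal (4 * t ^ (q - 3)) *
      {y | ‖f y‖ ^ (p - 1) * t ≤ 2 * A}.indicator (fun y => ‖f y‖ₑ ^ (2 : ℝ)) y := by
        rw [lintegral_lintegral_swap]
        exact hmeas.aemeasurable
    _ ≤ ENNReal.ofReal q *
        ∫⁻ y, ENNReal.ofReal (4 * (2 * A) ^ (q - 2) / (q - 2) * ‖f y‖ ^ p) := by
        gcongr 2 with y
        exact hslice y
    _ = _ := by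
        rw [← ofReal_integral_eq_lintegral_ofReal (hfp.const_mul _)
          (ae_of_all _ fun y => by simp only [Pi.zero_apply]; positivity), integral_const_mul, hfA,
          ← ENNReal.ofReal_mul (by linarith), Real.mul_rpow (by norm_num) hA.le]
        congr 1
        rw [show q - 1 = q - 2 + 1 by ring, Real.rpow_add_one hA.ne']
        field_simp

lemma eLpNorm_ofReal_eq {α F : Type*} [MeasurableSpace α] {μ : Measure α} [NormedAddCommGroup F]
    (f : α → F) {p : ℝ} (hp : 0 < p) :
    eLpNorm f (ENNReal.ofReal p) μ = (∫⁻ x, ‖f x‖ₑ ^ p ∂μ) ^ (1 / p) := by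
  rw [eLpNorm_eq_lintegral_rpow_enorm_toReal (by simpa using hp) (by simp),
    ENNReal.toReal_ofReal hp.le]

/-- **Hausdorff–Young inequality**, up to a constant. -/
lemma exists_eLpNorm_fourier_le {q : ℝ} (hq : 2 < q) : ∃ C : ℝ≥0, 0 < C ∧
    ∀ {N : ℕ} {f : EuclideanSpace ℝ (Fin N) → ℂ}, Integrable f →
      eLpNorm (𝓕 f) (ENNReal.ofReal q) volume ≤
        C * eLpNorm f (ENNReal.ofReal (q / (q - 1))) volume := by
  have hq1 : 0 < q - 1 := by linarith
  have hq2 : 0 < q - 2 := by linarith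
  have hp0 : 0 < q / (q - 1) := by positivity
  set K := 4 * q * 2 ^ (q - 2) / (q - 2) with hK
  have hK0 : 0 < K := by positivity
  refine ⟨(K ^ (1 / q)).toNNReal, by simpa using by positivity, ?_⟩
  intro N f hf
  wlog hfm : Measurable f generalizing f
  · have hae := hf.1.ae_eq_mk
    have h1 : 𝓕 f = 𝓕 (hf.1.mk f) := by
      ext x
      simp only [Real.fourier_eq]
      refine integral_congr_ae ?_
      filter_upwards [hae] with y hy
      rw [hy]
    rw [h1, eLpNorm_congr_ae hae]
    exact this (hf.congr hae) hf.1.stronglyMeasurable_mk.measurable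
  set p := q / (q - 1) with hp
  by_cases htop : eLpNorm f (ENNReal.ofReal p) volume = ⊤
  · rw [htop, ENNReal.mul_top]
    · exact le_top
    · simpa using by positivity
  by_cases hzero : eLpNorm f (ENNReal.ofReal p) volume = 0
  · rw [eLpNorm_eq_zero_iff hf.1 (by simpa using hp0)] at hzero
    have h1 : 𝓕 f = 0 := by
      ext x
      simp only [Real.fourier_eq, Pi.zero_apply]
      refine integral_eq_zero_of_ae ?_
      filter_upwards [hzero] with y hy
      simp [hy]
    simp [h1]
  have hmem : MemLp f (ENNReal.ofReal p) volume := ⟨hf.1, lt_top_iff_ne_top.2 htop⟩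
  have hfp : Integrable fun y => ‖f y‖ ^ p := by
    have := hmem.integrable_norm_rpow (by simpa using hp0) (by simp)
    rwa [ENNReal.toReal_ofReal hp0.le] at this
  set A := ∫ y, ‖f y‖ ^ p with hA
  have hlin : ∫⁻ y, ‖f y‖ₑ ^ p = ENNReal.ofReal A := by
    rw [hA, ofReal_integral_eq_lintegral_ofReal hfp (ae_of_all _ fun y => by
      simp only [Pi.zero_apply]; positivity)]
    congr 1 with y
    rw [← ofReal_norm, ENNReal.ofReal_rpow_of_nonneg (norm_nonneg _) hp0.le]
  have hA0 : 0 < A := by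
    by_contra hcon
    apply hzero
    rw [eLpNorm_ofReal_eq _ hp0, hlin, ENNReal.ofReal_of_nonpos (not_lt.1 hcon),
      ENNReal.zero_rpow_of_pos (by positivity)]
  rw [eLpNorm_ofReal_eq _ (by linarith), eLpNorm_ofReal_eq _ hp0, hlin]
  calc _ ≤ (ENNReal.ofReal (K * A ^ (q - 1))) ^ (1 / q) := by
        gcongr
        exact lintegral_fourier_rpow_le hf hfm hA0 hfp hq hp rfl
    _ = _ := by
        rw [ENNReal.ofReal_mul hK0.le, ENNReal.mul_rpow_of_nonneg _ _ (by positivity),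
          ENNReal.ofReal_rpow_of_nonneg hK0.le (by positivity),
          ENNReal.ofReal_rpow_of_nonneg (by positivity) (by positivity),
          ENNReal.ofReal_rpow_of_nonneg (by positivity) (by positivity),
          ← Real.rpow_mul hA0.le]
        congr 3
        rw [hp]
        field_simp

lemma norm_schrodingerProp {N : ℕ} {t : ℝ} (ht : t ≠ 0) (φ : EuclideanSpace ℝ (Fin N) → ℂ)
    (x : EuclideanSpace ℝ (Fin N)) :
    ‖schrodingerProp N t φ x‖ = (4 * π * |t|) ^ (-(N : ℝ) / 2) *
      ‖𝓕 (fun y => Complex.exp (Complex.I * ((‖y‖ ^ 2 / (4 * t) : ℝ) : ℂ)) * φ y)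
        ((4 * π * t)⁻¹ • x)‖ := by
  have h1 : ∀ y, Complex.exp (Complex.I * ((‖x - y‖ ^ 2 / (4 * t) : ℝ) : ℂ)) * φ y =
      Complex.exp (Complex.I * ((‖x‖ ^ 2 / (4 * t) : ℝ) : ℂ)) *
      (𝐞 (-inner ℝ y ((4 * π * t)⁻¹ • x)) •
        (Complex.exp (Complex.I * ((‖y‖ ^ 2 / (4 * t) : ℝ) : ℂ)) * φ y)) := by
    intro y
    rw [Circle.smul_def, Real.fourierChar_apply, smul_eq_mul, ← mul_assoc, ← mul_assoc,
      ← Complex.exp_add, ← Complex.exp_add]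
    congr 2
    rw [norm_sub_sq_real, inner_smul_right, real_inner_comm]
    have hpi : (π : ℂ) ≠ 0 := by exact_mod_cast Real.pi_ne_zero
    have ht' : (t : ℂ) ≠ 0 := by exact_mod_cast ht
    push_cast
    field_simp
    ring
  have h2 : (-(N : ℂ) / 2) = ((-(N : ℝ) / 2 : ℝ) : ℂ) := by push_cast; rfl
  rw [schrodingerProp, if_neg ht, norm_mul, h2, Complex.norm_cpow_real]
  simp_rw [h1]
  rw [integral_const_mul, norm_mul (Complex.exp _), Complex.norm_exp_I_mul_ofReal, one_mul, Real.fourier_eq]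
  congr 2
  simp [abs_of_pos Real.pi_pos]

lemma lintegral_comp_smul_inv {N : ℕ} {R : ℝ} (hR : R ≠ 0)
    {g : EuclideanSpace ℝ (Fin N) → ℝ≥0∞} (hg : Measurable g) :
    ∫⁻ x, g (R⁻¹ • x) = ENNReal.ofReal (|R| ^ N) * ∫⁻ x, g x := by
  rw [← lintegral_map (f := g) (g := fun x => R⁻¹ • x) hg (measurable_const_smul _),
    Measure.map_addHaar_smul volume (inv_ne_zero hR), lintegral_smul_measure]
  simp [abs_pow]

/-- Dispersive estimate for the free Schrödinger propagator. -/
lemma exists_eLpNorm_schrodingerProp_le {q : ℝ} (hq : 2 < q) : ∃ C : ℝ≥0, 0 < C ∧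
    ∀ {N : ℕ} {φ : EuclideanSpace ℝ (Fin N) → ℂ}, Integrable φ → ∀ {t : ℝ}, t ≠ 0 →
      eLpNorm (schrodingerProp N t φ) (ENNReal.ofReal q) volume ≤
        ENNReal.ofReal ((4 * π * |t|) ^ ((N : ℝ) / q - (N : ℝ) / 2)) *
          (C * eLpNorm φ (ENNReal.ofReal (q / (q - 1))) volume) := by
  obtain ⟨C, hC, H⟩ := exists_eLpNorm_fourier_le hq
  refine ⟨C, hC, fun {N} {φ} hφ {t} ht => ?_⟩
  set ψ : EuclideanSpace ℝ (Fin N) → ℂ :=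
    fun y => Complex.exp (Complex.I * ((‖y‖ ^ 2 / (4 * t) : ℝ) : ℂ)) * φ y with hψ
  have hnorm : ∀ y, ‖ψ y‖ = ‖φ y‖ := fun y => by
    rw [hψ]
    simp only
    rw [norm_mul, Complex.norm_exp_I_mul_ofReal, one_mul]
  have hψi : Integrable ψ := by
    refine (integrable_norm_iff ?_).1 ?_
    · refine AEStronglyMeasurable.mul (Continuous.aestronglyMeasurable ?_) hφ.1
      fun_prop
    · simpa only [hnorm] using hφ.norm
  have hψn : eLpNorm ψ (ENNReal.ofReal (q / (q - 1))) volume =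
      eLpNorm φ (ENNReal.ofReal (q / (q - 1))) volume :=
    eLpNorm_congr_norm_ae (ae_of_all _ hnorm)
  have hcont : Continuous (𝓕 ψ) :=
    VectorFourier.fourierIntegral_continuous Real.continuous_fourierChar
      (by exact continuous_inner) hψi
  have hpos : 0 < 4 * π * |t| := by have := abs_pos.2 ht; positivity
  have hRne : 4 * π * t ≠ 0 := by have := Real.pi_ne_zero; positivity
  have hR : |4 * π * t| = 4 * π * |t| := by
    rw [abs_mul, abs_of_pos (by positivity : 0 < 4 * π)]
  rw [← hψn]
  refine le_trans (le_of_eq ?_) (mul_le_mul_right (H hψi) _)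
  rw [eLpNorm_ofReal_eq _ (by linarith), eLpNorm_ofReal_eq _ (by linarith)]
  have h1 : ∀ x, ‖schrodingerProp N t φ x‖ₑ ^ q =
      ENNReal.ofReal ((4 * π * |t|) ^ (-(N : ℝ) / 2 * q)) *
        (fun z => ‖𝓕 ψ z‖ₑ ^ q) ((4 * π * t)⁻¹ • x) := by
    intro x
    rw [← ofReal_norm, norm_schrodingerProp ht, ENNReal.ofReal_mul (by positivity),
      ENNReal.mul_rpow_of_nonneg _ _ (by linarith),
      ENNReal.ofReal_rpow_of_nonneg (by positivity) (by linarith), ofReal_norm,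
      ← Real.rpow_mul hpos.le]
  simp_rw [h1]
  rw [lintegral_const_mul' _ _ ENNReal.ofReal_ne_top,
    lintegral_comp_smul_inv hRne (hcont.measurable.enorm.pow_const _), ← mul_assoc, hR,
    ← ENNReal.ofReal_mul (by positivity), ENNReal.mul_rpow_of_nonneg _ _ (by positivity),
    ENNReal.ofReal_rpow_of_nonneg (by positivity) (by positivity)]
  congr 2
  rw [← Real.rpow_natCast, ← Real.rpow_add hpos, ← Real.rpow_mul hpos.le]
  congr 1
  field_simp
  ring

/-- Sobolev-type embedding on the Fourier side. -/
lemma exists_eLpNorm_le_eLpNorm_weight_fourier {N : ℕ} {q a b k : ℝ} (hq : 2 < q) (ha : 0 < a)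
    (hb : 0 < b) (hk : 0 ≤ k) (hab : (q - 1) / q = 1 / a + 1 / b) (hN : (N : ℝ) < k * b) :
    ∃ C : ℝ≥0, 0 < C ∧ ∀ v : SchwartzMap (EuclideanSpace ℝ (Fin N)) ℂ,
      eLpNorm v (ENNReal.ofReal q) volume ≤
        C * eLpNorm (fun ξ => (((1 + ‖ξ‖) ^ k : ℝ) : ℂ) * 𝓕 v ξ) (ENNReal.ofReal a) volume := by
  obtain ⟨C, hC, H⟩ := exists_eLpNorm_fourier_le hq
  have hq1 : 0 < q - 1 := by linarith
  set W : ℝ≥0∞ := (∫⁻ ξ : EuclideanSpace ℝ (Fin N),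
    (ENNReal.ofReal ((1 + ‖ξ‖) ^ (-k))) ^ b) ^ (1 / b) with hW
  have hWtop : W ≠ ⊤ := by
    refine ENNReal.rpow_ne_top_of_nonneg (by positivity) ?_
    have h := finite_integral_one_add_norm (μ := (volume : Measure (EuclideanSpace ℝ (Fin N))))
      (r := k * b) (by simpa using hN)
    convert! h.ne using 3 with ξ
    rw [ENNReal.ofReal_rpow_of_nonneg (by positivity) hb.le, ← Real.rpow_mul (by positivity)]
    ring_nf
  refine ⟨C * (W.toNNReal + 1), by positivity, fun v => ?_⟩
  have h1 : eLpNorm v (ENNReal.ofReal q) volume =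
      eLpNorm (𝓕 (𝓕 (v : EuclideanSpace ℝ (Fin N) → ℂ))) (ENNReal.ofReal q) volume := by
    have hinv : (𝓕 (𝓕 (v : EuclideanSpace ℝ (Fin N) → ℂ))) = v ∘ Neg.neg := by
      ext x
      have h2 : (𝓕⁻ (𝓕 v)) (-x) = v (-x) := by rw [FourierTransform.fourierInv_fourier_eq]
      rw [SchwartzMap.fourierInv_coe, Real.fourierInv_eq_fourier_neg, neg_neg,
        SchwartzMap.fourier_coe] at h2
      exact h2
    rw [hinv, eLpNorm_comp_measurePreserving v.continuous.aestronglyMeasurable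
      (Measure.measurePreserving_neg volume)]
  have h_int : Integrable (𝓕 (v : EuclideanSpace ℝ (Fin N) → ℂ)) :=
    (𝓕 v : SchwartzMap (EuclideanSpace ℝ (Fin N)) ℂ).integrable
  have hcont : Continuous (𝓕 (v : EuclideanSpace ℝ (Fin N) → ℂ)) :=
    (𝓕 v : SchwartzMap (EuclideanSpace ℝ (Fin N)) ℂ).continuous
  rw [h1]
  refine (H h_int).trans ?_
  push_cast
  rw [mul_assoc]
  gcongr
  have hp0 : 0 < q / (q - 1) := by positivity
  have hpa : q / (q - 1) < a := by
    rw [div_lt_iff₀ hq1]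
    have : 0 < 1 / b := by positivity
    have h3 : 1 / a < (q - 1) / q := by linarith
    rw [div_lt_div_iff₀ ha (by linarith)] at h3
    linarith
  rw [eLpNorm_ofReal_eq _ hp0, eLpNorm_ofReal_eq _ ha]
  have h4 := ENNReal.lintegral_Lp_mul_le_Lq_mul_Lr hp0 hpa (r := b)
    (by rw [one_div_div]; exact hab) volume
    (f := fun ξ : EuclideanSpace ℝ (Fin N) => ‖(((1 + ‖ξ‖) ^ k : ℝ) : ℂ) * 𝓕 v ξ‖ₑ)
    (g := fun ξ => ENNReal.ofReal ((1 + ‖ξ‖) ^ (-k)))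
    (by have : Measurable (𝓕 (v : EuclideanSpace ℝ (Fin N) → ℂ)) := hcont.measurable
        simp only [SchwartzMap.fourier_coe]
        fun_prop)
    (by fun_prop)
  rw [← hW] at h4
  have h5 : ∀ ξ : EuclideanSpace ℝ (Fin N), ‖𝓕 v ξ‖ₑ =
      ‖(((1 + ‖ξ‖) ^ k : ℝ) : ℂ) * 𝓕 v ξ‖ₑ * ENNReal.ofReal ((1 + ‖ξ‖) ^ (-k)) := by
    intro ξ
    rw [← ofReal_norm, ← ofReal_norm, ← ENNReal.ofReal_mul (norm_nonneg _), norm_mul,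
      Complex.norm_real, Real.norm_of_nonneg (by positivity),
      Real.rpow_neg (by positivity)]
    congr 1
    have : 0 < (1 + ‖ξ‖) ^ k := by positivity
    field_simp
  calc _ = _ := by
        congr 2 with ξ
        rw [← SchwartzMap.fourier_coe, h5 ξ]
        rfl
    _ ≤ _ := h4
    _ ≤ _ := by
      rw [mul_comm]
      gcongr
      rw [ENNReal.coe_toNNReal hWtop]
      exact le_self_add

/-- The Sobolev embedding of `H¹` into `L^q` in the subcritical range, for Schwartz functions. -/
lemma exists_eLpNorm_le_sobolev {N : ℕ} {q : ℝ} (hq : 2 < q) (hN : (N : ℝ) * (q - 2) < 2 * q) :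
    ∃ C : ℝ≥0, 0 < C ∧ ∀ v : SchwartzMap (EuclideanSpace ℝ (Fin N)) ℂ,
      eLpNorm v (ENNReal.ofReal q) volume ≤
        C * (eLpNorm v 2 volume + eLpNorm (fun x => fderiv ℝ v x) 2 volume) := by
  have hq2 : 0 < q - 2 := by linarith
  obtain ⟨C, hC, H⟩ := exists_eLpNorm_le_eLpNorm_weight_fourier (N := N) (q := q) (a := 2)
    (b := 2 * q / (q - 2)) (k := 1) hq (by norm_num) (by positivity) zero_le_one
    (by field_simp; ring) (by rw [one_mul, lt_div_iff₀ hq2]; exact hN)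
  refine ⟨C * (1 + N), by positivity, fun v => (H v).trans ?_⟩
  push_cast
  rw [mul_assoc]
  gcongr
  have hL2 : ∀ w : SchwartzMap (EuclideanSpace ℝ (Fin N)) ℂ,
      eLpNorm (𝓕 w : SchwartzMap (EuclideanSpace ℝ (Fin N)) ℂ) 2 volume = eLpNorm w 2 volume := fun w => by
    rw [SchwartzMap.fourier_coe]
    exact eLpNorm_fourier_two w.integrable (w.memLp 2 volume)
  have hderiv : ∀ i, eLpNorm (𝓕 (LineDeriv.lineDerivOp (basisVec N i) v) :
      SchwartzMap (EuclideanSpace ℝ (Fin N)) ℂ) 2 volume ≤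
      eLpNorm (fun x => fderiv ℝ v x) 2 volume := fun i => by
    rw [hL2]
    refine eLpNorm_mono fun x => ?_
    rw [SchwartzMap.lineDerivOp_apply_eq_fderiv]
    refine (ContinuousLinearMap.le_opNorm _ _).trans ?_
    simp [basisVec]
  have hpt : ∀ ξ, ‖(((1 + ‖ξ‖) ^ (1 : ℝ) : ℝ) : ℂ) * 𝓕 v ξ‖ ≤
      ‖‖𝓕 v ξ‖ + ∑ i : Fin N, ‖𝓕 (LineDeriv.lineDerivOp (basisVec N i) v) ξ‖‖ := by
    intro ξ
    have h1 : ∀ i, ‖ξ i‖ * ‖𝓕 v ξ‖ ≤ ‖𝓕 (LineDeriv.lineDerivOp (basisVec N i) v) ξ‖ := by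
      intro i
      have htg : (inner ℝ · (basisVec N i)).HasTemperateGrowth :=
        ((innerSL ℝ).flip (basisVec N i)).hasTemperateGrowth
      rw [SchwartzMap.fourier_lineDerivOp_eq, smul_apply,
        SchwartzMap.smulLeftCLM_apply_apply htg]
      have h3 : (inner ℝ ξ (basisVec N i) : ℝ) = ξ i := by
        simp [basisVec, EuclideanSpace.inner_single_right]
      rw [h3, norm_smul, norm_smul]
      have h2 : (1 : ℝ) ≤ ‖(2 * π * Complex.I : ℂ)‖ := by
        simp only [Complex.norm_mul, Complex.norm_ofNat, Complex.norm_real, Complex.norm_I,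
          mul_one, Real.norm_of_nonneg Real.pi_pos.le]
        linarith [Real.pi_gt_three]
      exact le_mul_of_one_le_left (by positivity) h2
    have h4 : ‖ξ‖ ≤ ∑ i, ‖ξ i‖ := by
      rw [EuclideanSpace.norm_eq]
      refine Real.sqrt_le_iff.2 ⟨by positivity, ?_⟩
      exact Finset.sum_sq_le_sq_sum_of_nonneg fun i _ => norm_nonneg _
    rw [Real.rpow_one, norm_mul, Complex.norm_real, Real.norm_of_nonneg (by positivity),
      Real.norm_of_nonneg (by positivity), add_mul, one_mul]
    gcongr
    calc _ ≤ (∑ i, ‖ξ i‖) * ‖𝓕 v ξ‖ := by gcongr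
      _ ≤ _ := by
        rw [Finset.sum_mul]
        exact Finset.sum_le_sum fun i _ => h1 i
  rw [show ENNReal.ofReal 2 = 2 by simp]
  have hm : ∀ w : SchwartzMap (EuclideanSpace ℝ (Fin N)) ℂ,
      AEStronglyMeasurable (fun ξ => ‖w ξ‖) volume :=
    fun w => w.continuous.norm.aestronglyMeasurable
  calc _ ≤ _ := eLpNorm_mono hpt
    _ ≤ eLpNorm (fun ξ => ‖𝓕 v ξ‖) 2 volume + ∑ i : Fin N,
        eLpNorm (fun ξ => ‖𝓕 (LineDeriv.lineDerivOp (basisVec N i) v) ξ‖) 2 volume := by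
      refine (eLpNorm_add_le (hm _) ?_ (by norm_num)).trans ?_
      · exact Finset.aestronglyMeasurable_fun_sum _ fun i _ => hm _
      · gcongr
        have := eLpNorm_sum_le (s := Finset.univ) (p := 2) (μ := volume)
          (f := fun (i : Fin N) ξ => ‖𝓕 (LineDeriv.lineDerivOp (basisVec N i) v) ξ‖)
          (fun i _ => hm _) (by norm_num)
        convert! this using 2
        ext ξ
        simp
    _ ≤ eLpNorm v 2 volume + ∑ i : Fin N, eLpNorm (fun x => fderiv ℝ v x) 2 volume := by
      gcongr with i
      · rw [eLpNorm_norm, hL2]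
      · rw [eLpNorm_norm]
        exact hderiv i
    _ ≤ _ := by
      simp only [Finset.sum_const, Finset.card_univ, Fintype.card_fin, nsmul_eq_mul]
      rw [add_mul, one_mul, mul_add]
      gcongr
      · exact le_self_add
      · exact le_add_self

lemma SchwartzMap.lineDerivOp_postcompCLM_ofReal {N : ℕ}
    (u : SchwartzMap (EuclideanSpace ℝ (Fin N)) ℝ) (m : EuclideanSpace ℝ (Fin N)) :
    LineDeriv.lineDerivOp m (u.postcompCLM Complex.ofRealCLM) =
      (LineDeriv.lineDerivOp m u).postcompCLM Complex.ofRealCLM := by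
  ext x
  rw [SchwartzMap.lineDerivOp_apply_eq_fderiv, SchwartzMap.postcompCLM_apply,
    SchwartzMap.lineDerivOp_apply_eq_fderiv]
  have h : HasFDerivAt (u.postcompCLM Complex.ofRealCLM) (Complex.ofRealCLM.comp (fderiv ℝ u x)) x :=
    Complex.ofRealCLM.hasFDerivAt.comp x u.differentiableAt.hasFDerivAt
  rw [h.fderiv]
  rfl

lemma laplacian_postcompCLM_ofReal_apply {N : ℕ} (u : SchwartzMap (EuclideanSpace ℝ (Fin N)) ℝ)
    (x : EuclideanSpace ℝ (Fin N)) :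
    (Laplacian.laplacian (u.postcompCLM Complex.ofRealCLM) :
      SchwartzMap (EuclideanSpace ℝ (Fin N)) ℂ) x = ((lap N u x : ℝ) : ℂ) := by
  rw [SchwartzMap.laplacian_eq_sum (EuclideanSpace.basisFun (Fin N) ℝ), sum_apply, lap,
    Complex.ofReal_sum]
  refine Finset.sum_congr rfl fun i _ => ?_
  rw [SchwartzMap.lineDerivOp_postcompCLM_ofReal, SchwartzMap.lineDerivOp_postcompCLM_ofReal,
    SchwartzMap.postcompCLM_apply, SchwartzMap.lineDerivOp_apply_eq_fderiv,
    EuclideanSpace.basisFun_apply]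
  rfl

lemma lap_eq_laplacian {N : ℕ} (u : SchwartzMap (EuclideanSpace ℝ (Fin N)) ℝ)
    (x : EuclideanSpace ℝ (Fin N)) :
    lap N u x = (Laplacian.laplacian u : SchwartzMap (EuclideanSpace ℝ (Fin N)) ℝ) x := by
  rw [SchwartzMap.laplacian_eq_sum (EuclideanSpace.basisFun (Fin N) ℝ), sum_apply, lap]
  refine Finset.sum_congr rfl fun i _ => ?_
  rw [SchwartzMap.lineDerivOp_apply_eq_fderiv, EuclideanSpace.basisFun_apply]
  rfl

lemma lap_sub {N : ℕ} (u₁ u₂ : SchwartzMap (EuclideanSpace ℝ (Fin N)) ℝ)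
    (x : EuclideanSpace ℝ (Fin N)) :
    lap N (u₁ - u₂ : SchwartzMap (EuclideanSpace ℝ (Fin N)) ℝ) x = lap N u₁ x - lap N u₂ x := by
  rw [lap_eq_laplacian, lap_eq_laplacian, lap_eq_laplacian, ← SchwartzMap.laplacianCLM_eq',
    map_sub]
  rfl

/-- The resolvent equation `u - α²Δu = g` on the Fourier side. -/
lemma fourier_sub_lap {N : ℕ} (α : ℝ) (u : SchwartzMap (EuclideanSpace ℝ (Fin N)) ℝ) :
    ∃ g : SchwartzMap (EuclideanSpace ℝ (Fin N)) ℂ,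
      (∀ x, g x = ((u x - α ^ 2 * lap N u x : ℝ) : ℂ)) ∧
      ∀ ξ, 𝓕 g ξ = ((1 + α ^ 2 * (2 * π * ‖ξ‖) ^ 2 : ℝ) : ℂ) *
        𝓕 (u.postcompCLM Complex.ofRealCLM) ξ := by
  set w := u.postcompCLM Complex.ofRealCLM with hw
  refine ⟨w + (-α ^ 2) • Laplacian.laplacian w, fun x => ?_, fun ξ => ?_⟩
  · rw [add_apply, smul_apply, hw, laplacian_postcompCLM_ofReal_apply]
    simp [sub_eq_add_neg]
  · have htg : (fun ξ : EuclideanSpace ℝ (Fin N) => ‖ξ‖ ^ 2).HasTemperateGrowth := by fun_prop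
    have h1 : (𝓕 (w + (-α ^ 2) • Laplacian.laplacian w) :
        SchwartzMap (EuclideanSpace ℝ (Fin N)) ℂ) =
        𝓕 w + (-α ^ 2) • 𝓕 (Laplacian.laplacian w) := by
      rw [FourierTransform.fourier_add, FourierTransform.fourier_smul]
    have h2 : (𝓕 (Laplacian.laplacian w) : SchwartzMap (EuclideanSpace ℝ (Fin N)) ℂ) =
        (-(2 * π) ^ 2) • SchwartzMap.smulLeftCLM ℂ (fun ξ : EuclideanSpace ℝ (Fin N) => ‖ξ‖ ^ 2)
          (𝓕 w) := by
      rw [SchwartzMap.laplacian_eq_fourierMultiplierCLM, FourierTransform.fourier_smul,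
        SchwartzMap.fourierMultiplierCLM_apply, FourierTransform.fourier_fourierInv_eq]
    rw [h1, h2, add_apply, smul_apply, smul_apply, SchwartzMap.smulLeftCLM_apply_apply htg]
    simp only [Complex.real_smul]
    push_cast
    ring

lemma postcompCLM_ofReal_eq_fourierInv {N : ℕ} (α : ℝ)
    (u : SchwartzMap (EuclideanSpace ℝ (Fin N)) ℝ) (x : EuclideanSpace ℝ (Fin N)) :
    (u x : ℂ) = 𝓕⁻ (fun ξ => (((1 + α ^ 2 * (2 * π * ‖ξ‖) ^ 2)⁻¹ : ℝ) : ℂ) *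
      𝓕 (fun y => ((u y - α ^ 2 * lap N u y : ℝ) : ℂ)) ξ) x := by
  obtain ⟨g, hg, hF⟩ := fourier_sub_lap α u
  have h1 : (u x : ℂ) = (𝓕⁻ (𝓕 (u.postcompCLM Complex.ofRealCLM)) :
      SchwartzMap (EuclideanSpace ℝ (Fin N)) ℂ) x := by
    rw [FourierTransform.fourierInv_fourier_eq]
    rfl
  rw [h1, SchwartzMap.fourierInv_coe]
  refine congrArg (fun f : EuclideanSpace ℝ (Fin N) → ℂ => 𝓕⁻ f x) (funext fun ξ => ?_)
  have h2 : (fun y => ((u y - α ^ 2 * lap N u y : ℝ) : ℂ)) = g := (funext hg).symm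
  rw [h2, ← SchwartzMap.fourier_coe, hF, ← mul_assoc, ← Complex.ofReal_mul, inv_mul_cancel₀
    (by positivity)]
  simp

/-- Elliptic regularity for the Helmholtz operator `1 - α²Δ`, from the dual exponent of `s` to `s`. -/
lemma exists_eLpNorm_le_eLpNorm_sub_lap {N : ℕ} {α s : ℝ} (hα : 0 < α) (hs : 2 < s)
    (hN : (N : ℝ) * (s - 2) < 2 * s) :
    ∃ C : ℝ≥0, 0 < C ∧ ∀ u : SchwartzMap (EuclideanSpace ℝ (Fin N)) ℝ,
      eLpNorm u (ENNReal.ofReal s) volume ≤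
        C * eLpNorm (fun x => u x - α ^ 2 * lap N u x) (ENNReal.ofReal (s / (s - 1))) volume := by
  have hs2 : 0 < s - 2 := by linarith
  obtain ⟨C₁, hC₁, H₁⟩ := exists_eLpNorm_le_eLpNorm_weight_fourier (N := N) (q := s) (a := s)
    (b := s / (s - 2)) (k := 2) hs (by linarith) (by positivity) zero_le_two
    (by field_simp; ring) (by rw [← mul_div_assoc, lt_div_iff₀ hs2]; exact hN)
  obtain ⟨C₂, hC₂, H₂⟩ := exists_eLpNorm_fourier_le hs
  set K : ℝ≥0 := NNReal.mk (2 * (1 + 1 / α ^ 2)) (by positivity) with hK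
  have hK0 : 0 < K := by
    rw [← NNReal.coe_pos, hK, NNReal.coe_mk]
    positivity
  refine ⟨C₁ * (K * C₂), by positivity, fun u => ?_⟩
  obtain ⟨g, hg, hF⟩ := fourier_sub_lap α u
  have h1 : eLpNorm u (ENNReal.ofReal s) volume =
      eLpNorm (u.postcompCLM Complex.ofRealCLM) (ENNReal.ofReal s) volume := by
    refine eLpNorm_congr_norm_ae (ae_of_all _ fun x => ?_)
    simp
  have h2 : eLpNorm (fun x => u x - α ^ 2 * lap N u x) (ENNReal.ofReal (s / (s - 1))) volume =
      eLpNorm g (ENNReal.ofReal (s / (s - 1))) volume := by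
    refine eLpNorm_congr_norm_ae (ae_of_all _ fun x => ?_)
    rw [hg, Complex.norm_real]
  rw [h1, h2]
  refine (H₁ _).trans ?_
  push_cast
  rw [mul_assoc, mul_assoc]
  gcongr
  refine le_trans ?_ (mul_le_mul_right (H₂ g.integrable) _)
  refine eLpNorm_le_nnreal_smul_eLpNorm_of_ae_le_mul (ae_of_all _ fun ξ => ?_) _
  rw [← SchwartzMap.fourier_coe, hF]
  simp only [← NNReal.coe_le_coe, NNReal.coe_mul, coe_nnnorm, norm_mul, Complex.norm_real]
  rw [← mul_assoc, Real.norm_of_nonneg (by positivity), Real.norm_of_nonneg (by positivity)]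
  gcongr
  rw [hK, NNReal.coe_mk]
  have h3 : (1 : ℝ) ≤ (2 * π) ^ 2 := by
    have := Real.pi_gt_three
    nlinarith
  have h4 : ‖ξ‖ ^ 2 ≤ (2 * π * ‖ξ‖) ^ 2 := by
    rw [mul_pow]
    exact le_mul_of_one_le_left (by positivity) h3
  have h5 : 1 / α ^ 2 * (α ^ 2 * (2 * π * ‖ξ‖) ^ 2) = (2 * π * ‖ξ‖) ^ 2 := by
    field_simp
  have h6 : 0 < 1 / α ^ 2 := by positivity
  have h7 : 0 ≤ α ^ 2 * (2 * π * ‖ξ‖) ^ 2 := by positivity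
  rw [Real.rpow_two]
  nlinarith [sq_nonneg (1 - ‖ξ‖)]

lemma rpow_sub_rpow_le {a b p : ℝ} (hb : 0 ≤ b) (hab : b ≤ a) (hp : 1 ≤ p) :
    a ^ p - b ^ p ≤ p * a ^ (p - 1) * (a - b) := by
  rcases (hb.trans hab).eq_or_lt with h | ha
  · have : b = 0 := le_antisymm (hab.trans h.symm.le) hb
    rw [← h, this]
    simp
  · have h1 := one_add_mul_self_le_rpow_one_add (s := b / a - 1) (by
      have : 0 ≤ b / a := by positivity
      linarith) hp
    rw [add_sub_cancel, Real.div_rpow hb ha.le] at h1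
    have hap : 0 < a ^ p := by positivity
    rw [le_div_iff₀ hap] at h1
    have h2 : a ^ p = a ^ (p - 1) * a := by
      rw [← Real.rpow_add_one ha.ne']
      simp
    have h3 : p * a ^ (p - 1) * (a - b) = p * (1 - b / a) * a ^ p := by
      rw [h2]
      field_simp
    rw [h3]
    linarith

lemma abs_rpow_sub_rpow_le {a b p : ℝ} (ha : 0 ≤ a) (hb : 0 ≤ b) (hp : 1 ≤ p) :
    |a ^ p - b ^ p| ≤ p * (a + b) ^ (p - 1) * |a - b| := by
  wlog hab : b ≤ a generalizing a b
  · rw [abs_sub_comm, abs_sub_comm a, add_comm a]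
    exact this hb ha (le_of_not_ge hab)
  · rw [abs_of_nonneg (sub_nonneg.2 (Real.rpow_le_rpow hb hab (by linarith))),
      abs_of_nonneg (sub_nonneg.2 hab)]
    refine (rpow_sub_rpow_le hb hab hp).trans ?_
    have : a ^ (p - 1) ≤ (a + b) ^ (p - 1) :=
      Real.rpow_le_rpow ha (by linarith) (by linarith)
    gcongr

lemma norm_rpow_mul_sub_rpow_mul_le {z w : ℂ} {σ : ℝ} (hσ : 1 ≤ σ) :
    ‖((‖z‖ ^ (σ - 1) : ℝ) : ℂ) * z - ((‖w‖ ^ (σ - 1) : ℝ) : ℂ) * w‖ ≤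
      (σ + 1) * (‖z‖ + ‖w‖) ^ (σ - 1) * ‖z - w‖ := by
  wlog hwz : ‖w‖ ≤ ‖z‖ generalizing z w
  · rw [norm_sub_rev, norm_sub_rev z, add_comm ‖z‖]
    exact this (le_of_not_ge hwz)
  have h1 : ((‖z‖ ^ (σ - 1) : ℝ) : ℂ) * z - ((‖w‖ ^ (σ - 1) : ℝ) : ℂ) * w =
      ((‖z‖ ^ (σ - 1) : ℝ) : ℂ) * (z - w) +
        ((‖z‖ ^ (σ - 1) - ‖w‖ ^ (σ - 1) : ℝ) : ℂ) * w := by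
    push_cast
    ring
  have h0 : ‖w‖ ^ (σ - 1) ≤ ‖z‖ ^ (σ - 1) := Real.rpow_le_rpow (norm_nonneg _) hwz (by linarith)
  have hrw : ∀ x : ℝ, 0 ≤ x → x ^ (σ - 1) * x = x ^ σ := fun x hx => by
    conv_rhs => rw [← sub_add_cancel σ 1, Real.rpow_add_of_nonneg hx (by linarith) zero_le_one,
      Real.rpow_one]
  have h2 : (‖z‖ ^ (σ - 1) - ‖w‖ ^ (σ - 1)) * ‖w‖ ≤ σ * ‖z‖ ^ (σ - 1) * ‖z - w‖ := by
    calc _ = ‖z‖ ^ (σ - 1) * ‖w‖ - ‖w‖ ^ σ := by rw [sub_mul, hrw _ (norm_nonneg _)]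
      _ ≤ ‖z‖ ^ (σ - 1) * ‖z‖ - ‖w‖ ^ σ := by gcongr
      _ = ‖z‖ ^ σ - ‖w‖ ^ σ := by rw [hrw _ (norm_nonneg _)]
      _ ≤ σ * ‖z‖ ^ (σ - 1) * (‖z‖ - ‖w‖) := rpow_sub_rpow_le (norm_nonneg _) hwz hσ
      _ ≤ _ := by
        gcongr
        exact norm_sub_norm_le z w
  have h3 : ‖z‖ ^ (σ - 1) ≤ (‖z‖ + ‖w‖) ^ (σ - 1) :=
    Real.rpow_le_rpow (norm_nonneg _) (by linarith [norm_nonneg w]) (by linarith)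
  rw [h1]
  refine (norm_add_le _ _).trans ?_
  rw [norm_mul, norm_mul, Complex.norm_real, Complex.norm_real,
    Real.norm_of_nonneg (by positivity), Real.norm_of_nonneg (sub_nonneg.2 h0)]
  calc _ ≤ ‖z‖ ^ (σ - 1) * ‖z - w‖ + σ * ‖z‖ ^ (σ - 1) * ‖z - w‖ := by gcongr
    _ = (σ + 1) * ‖z‖ ^ (σ - 1) * ‖z - w‖ := by ring
    _ ≤ _ := by gcongr

/-- Three-factor Hölder inequality, with a power on the second factor. -/
lemma eLpNorm_le_mul_rpow_mul {X E₀ E₁ E₂ E₃ : Type*} [MeasurableSpace X] {μ : Measure X}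
    [NormedAddCommGroup E₀] [NormedAddCommGroup E₁] [NormedAddCommGroup E₂]
    [NormedAddCommGroup E₃] {F : X → E₀} {f : X → E₁} {g : X → E₂} {h : X → E₃}
    (hf : AEStronglyMeasurable f μ) (hg : AEStronglyMeasurable g μ)
    (hh : AEStronglyMeasurable h μ) {p s r θ : ℝ} (hp : 0 < p) (hs : 0 < s) (hr : 0 < r)
    (hθ : 0 ≤ θ) (hpsr : 1 / p = 1 / s + θ / r + 1 / r) {c : ℝ≥0}
    (hF : ∀ x, ‖F x‖ ≤ c * ‖f x‖ * ‖g x‖ ^ θ * ‖h x‖) :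
    eLpNorm F (ENNReal.ofReal p) μ ≤ c * eLpNorm f (ENNReal.ofReal s) μ *
      eLpNorm g (ENNReal.ofReal r) μ ^ θ * eLpNorm h (ENNReal.ofReal r) μ := by
  have hF' : ∀ x, ‖F x‖ₑ ≤ c * (‖f x‖ₑ * ‖g x‖ₑ ^ θ * ‖h x‖ₑ) := by
    intro x
    rw [← ofReal_norm, ← ofReal_norm, ← ofReal_norm, ← ofReal_norm,
      ENNReal.ofReal_rpow_of_nonneg (norm_nonneg _) hθ, ← ENNReal.ofReal_mul (norm_nonneg _),
      ← ENNReal.ofReal_mul (by positivity), ← ENNReal.ofReal_coe_nnreal,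
      ← ENNReal.ofReal_mul (by positivity)]
    refine ENNReal.ofReal_le_ofReal ((hF x).trans (le_of_eq (by ring)))
  rw [eLpNorm_ofReal_eq _ hp, eLpNorm_ofReal_eq _ hs, eLpNorm_ofReal_eq _ hr,
    eLpNorm_ofReal_eq _ hr]
  have hH := ENNReal.lintegral_prod_norm_pow_le (μ := μ) (Finset.univ : Finset (Fin 3))
    (f := ![fun x => ‖f x‖ₑ ^ s, fun x => ‖g x‖ₑ ^ r, fun x => ‖h x‖ₑ ^ r])
    (by
      intro i _
      fin_cases i
      · exact hf.enorm.pow_const s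
      · exact hg.enorm.pow_const r
      · exact hh.enorm.pow_const r)
    (p := ![p / s, p * θ / r, p / r])
    (by
      simp only [Fin.sum_univ_three, Matrix.cons_val]
      have : p * (1 / p) = 1 := by field_simp
      rw [hpsr] at this
      rw [← this]
      ring)
    (by
      intro i _
      fin_cases i <;> simp <;> positivity)
  simp only [Fin.prod_univ_three, Matrix.cons_val] at hH
  simp only [← ENNReal.rpow_mul] at hH ⊢
  have hexp1 : s * (p / s) = p := by field_simp
  have hexp2 : r * (p * θ / r) = θ * p := by field_simp
  have hexp3 : r * (p / r) = p := by field_simp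
  rw [hexp1, hexp2, hexp3] at hH
  calc (∫⁻ x, ‖F x‖ₑ ^ p ∂μ) ^ (1 / p)
      ≤ (∫⁻ x, (c : ℝ≥0∞) ^ p * (‖f x‖ₑ ^ p * ‖g x‖ₑ ^ (θ * p) * ‖h x‖ₑ ^ p) ∂μ) ^ (1 / p) := by
        gcongr with x
        refine (ENNReal.rpow_le_rpow (hF' x) hp.le).trans (le_of_eq ?_)
        rw [ENNReal.mul_rpow_of_nonneg _ _ hp.le, ENNReal.mul_rpow_of_nonneg _ _ hp.le,
          ENNReal.mul_rpow_of_nonneg _ _ hp.le, ← ENNReal.rpow_mul]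
    _ = c * (∫⁻ x, (‖f x‖ₑ ^ p * ‖g x‖ₑ ^ (θ * p) * ‖h x‖ₑ ^ p) ∂μ) ^ (1 / p) := by
        rw [lintegral_const_mul' _ _ (ENNReal.rpow_ne_top_of_nonneg hp.le ENNReal.coe_ne_top),
          ENNReal.mul_rpow_of_nonneg _ _ (by positivity), ← ENNReal.rpow_mul,
          mul_one_div_cancel hp.ne', ENNReal.rpow_one]
    _ ≤ c * ((∫⁻ x, ‖f x‖ₑ ^ s ∂μ) ^ (p / s) * (∫⁻ x, ‖g x‖ₑ ^ r ∂μ) ^ (p * θ / r) *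
          (∫⁻ x, ‖h x‖ₑ ^ r ∂μ) ^ (p / r)) ^ (1 / p) := by gcongr
    _ = _ := by
        rw [ENNReal.mul_rpow_of_nonneg _ _ (by positivity),
          ENNReal.mul_rpow_of_nonneg _ _ (by positivity), ← ENNReal.rpow_mul, ← ENNReal.rpow_mul,
          ← ENNReal.rpow_mul, ← mul_assoc, ← mul_assoc,
          show p / s * (1 / p) = 1 / s by field_simp,
          show p * θ / r * (1 / p) = 1 / r * θ by field_simp,
          show p / r * (1 / p) = 1 / r by field_simp]

/-- Local Lipschitz estimate for the Hartree-type nonlinearity `u |v|^{σ-1} v`,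
`u - α²Δu = |v|^{σ+1}`, from `L^r` to `L^{r'}`. -/
lemma exists_eLpNorm_nonlinearity_sub_le {N : ℕ} {α s σ r : ℝ} (hα : 0 < α) (hs : 2 < s)
    (hN : (N : ℝ) * (s - 2) < 2 * s) (hσ : 1 ≤ σ) (hr : 2 < r)
    (hrs : 1 / s + (σ + 1) / r = 1) :
    ∃ C : ℝ≥0, 0 < C ∧ ∀ (v₁ v₂ : SchwartzMap (EuclideanSpace ℝ (Fin N)) ℂ)
      (u₁ u₂ : SchwartzMap (EuclideanSpace ℝ (Fin N)) ℝ),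
      (∀ x, u₁ x - α ^ 2 * lap N u₁ x = ‖v₁ x‖ ^ (σ + 1)) →
      (∀ x, u₂ x - α ^ 2 * lap N u₂ x = ‖v₂ x‖ ^ (σ + 1)) →
      eLpNorm (fun y => (u₁ y : ℂ) * ((‖v₁ y‖ ^ (σ - 1) : ℝ) : ℂ) * v₁ y
          - (u₂ y : ℂ) * ((‖v₂ y‖ ^ (σ - 1) : ℝ) : ℂ) * v₂ y)
        (ENNReal.ofReal (r / (r - 1))) volume ≤
      C * (eLpNorm v₁ (ENNReal.ofReal r) volume + eLpNorm v₂ (ENNReal.ofReal r) volume) ^ (2 * σ) *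
        eLpNorm (fun x => v₁ x - v₂ x) (ENNReal.ofReal r) volume := by
  obtain ⟨C, hC, H⟩ := exists_eLpNorm_le_eLpNorm_sub_lap (N := N) hα hs hN
  set c : ℝ≥0 := Real.toNNReal (σ + 1) with hc
  have hcσ : (c : ℝ) = σ + 1 := Real.coe_toNNReal _ (by linarith)
  have hc0 : 0 < c := by
    rw [← NNReal.coe_pos, hcσ]
    linarith
  have hr0 : 0 < r := by linarith
  have hs0 : 0 < s := by linarith
  have hs1 : 0 < s - 1 := by linarith
  have hr1 : 0 < r - 1 := by linarith
  refine ⟨2 * c * C, by positivity, fun v₁ v₂ u₁ u₂ h₁ h₂ => ?_⟩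
  have hmv₁ := v₁.continuous
  have hmv₂ := v₂.continuous
  have hmu₁ := u₁.continuous
  have hmu₂ := u₂.continuous
  set V : EuclideanSpace ℝ (Fin N) → ℝ := fun x => ‖v₁ x‖ + ‖v₂ x‖ with hV
  have hVm : AEStronglyMeasurable V volume :=
    (hmv₁.norm.add hmv₂.norm).aestronglyMeasurable
  have hwm : AEStronglyMeasurable (fun x => v₁ x - v₂ x) volume :=
    (hmv₁.sub hmv₂).aestronglyMeasurable
  have hV0 : ∀ x, 0 ≤ V x := fun x => by positivity
  have hVn : ∀ x, ‖V x‖ = V x := fun x => Real.norm_of_nonneg (hV0 x)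
  set A := eLpNorm v₁ (ENNReal.ofReal r) volume + eLpNorm v₂ (ENNReal.ofReal r) volume with hA
  set D := eLpNorm (fun x => v₁ x - v₂ x) (ENNReal.ofReal r) volume with hD
  have hVA : eLpNorm V (ENNReal.ofReal r) volume ≤ A := by
    rw [hA, ← eLpNorm_norm v₁, ← eLpNorm_norm v₂]
    exact eLpNorm_add_le hmv₁.norm.aestronglyMeasurable hmv₂.norm.aestronglyMeasurable
      (by rw [ENNReal.one_le_ofReal]; linarith)
  have hσ1 : 0 ≤ σ - 1 := by linarith
  have hexp1 : 1 / (s / (s - 1)) = 1 / r + (σ - 1) / r + 1 / r := by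
    rw [one_div_div, sub_div, div_self hs0.ne']
    linear_combination -hrs
  have hexp2 : 1 / (r / (r - 1)) = 1 / s + (σ - 1) / r + 1 / r := by
    rw [one_div_div, sub_div, div_self hr0.ne']
    linear_combination -hrs
  have hrw : ∀ x : ℝ, 0 ≤ x → x * x ^ (σ - 1) = x ^ σ := fun x hx => by
    conv_rhs => rw [← sub_add_cancel σ 1, Real.rpow_add_of_nonneg hx (by linarith) zero_le_one,
      Real.rpow_one, mul_comm]
  have hu₂ : eLpNorm u₂ (ENNReal.ofReal s) volume ≤ C * (A * A ^ (σ - 1) * A) := by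
    refine (H u₂).trans ?_
    simp_rw [h₂]
    gcongr
    refine (eLpNorm_le_mul_rpow_mul (c := 1) hVm hVm hVm (by positivity) hr0 hr0 hσ1 hexp1
      fun x => ?_).trans ?_
    · have hle : ‖v₂ x‖ ≤ V x := by simp [hV]
      simp only [hVn]
      rw [NNReal.coe_one, one_mul, hrw _ (hV0 x), Real.norm_of_nonneg (by positivity),
        Real.rpow_add_of_nonneg (norm_nonneg _) (by linarith) zero_le_one, Real.rpow_one]
      gcongr
    · rw [ENNReal.coe_one, one_mul]
      gcongr
  have hu₁₂ : eLpNorm (fun x => u₁ x - u₂ x) (ENNReal.ofReal s) volume ≤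
      C * (c * A * A ^ (σ - 1) * D) := by
    have hsub : ∀ x, (u₁ - u₂) x - α ^ 2 * lap N (u₁ - u₂ : SchwartzMap _ _) x =
        ‖v₁ x‖ ^ (σ + 1) - ‖v₂ x‖ ^ (σ + 1) := by
      intro x
      rw [← h₁, ← h₂, lap_sub, sub_apply]
      ring
    refine (H (u₁ - u₂)).trans ?_
    simp_rw [hsub]
    gcongr
    refine (eLpNorm_le_mul_rpow_mul (c := c) hVm hVm hwm (by positivity) hr0 hr0 hσ1 hexp1
      fun x => ?_).trans ?_
    · simp only [hVn]
      rw [hcσ, mul_assoc (σ + 1), hrw _ (hV0 x)]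
      refine (abs_rpow_sub_rpow_le (norm_nonneg _) (norm_nonneg _) (by linarith)).trans ?_
      rw [add_sub_cancel_right]
      gcongr
      exact abs_norm_sub_norm_le _ _
    · gcongr
  have hpt : ∀ y, (u₁ y : ℂ) * ((‖v₁ y‖ ^ (σ - 1) : ℝ) : ℂ) * v₁ y
          - (u₂ y : ℂ) * ((‖v₂ y‖ ^ (σ - 1) : ℝ) : ℂ) * v₂ y =
      ((u₁ y - u₂ y : ℝ) : ℂ) * (((‖v₁ y‖ ^ (σ - 1) : ℝ) : ℂ) * v₁ y) +
      (u₂ y : ℂ) * (((‖v₁ y‖ ^ (σ - 1) : ℝ) : ℂ) * v₁ y -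
        ((‖v₂ y‖ ^ (σ - 1) : ℝ) : ℂ) * v₂ y) := by
    intro y
    push_cast
    ring
  simp_rw [hpt]
  have hm : ∀ v : SchwartzMap (EuclideanSpace ℝ (Fin N)) ℂ,
      Continuous fun y => ((‖v y‖ ^ (σ - 1) : ℝ) : ℂ) * v y := fun v =>
    (Complex.continuous_ofReal.comp (v.continuous.norm.rpow_const fun _ => Or.inr hσ1)).mul
      v.continuous
  refine (eLpNorm_add_le ((Complex.continuous_ofReal.comp (hmu₁.sub hmu₂)).mul
    (hm v₁)).aestronglyMeasurable ((Complex.continuous_ofReal.comp hmu₂).mul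
    ((hm v₁).sub (hm v₂))).aestronglyMeasurable ?_).trans ?_
  · rw [ENNReal.one_le_ofReal, one_le_div hr1]
    linarith
  have e1 := eLpNorm_le_mul_rpow_mul (c := 1) (p := r / (r - 1))
    (F := fun y => ((u₁ y - u₂ y : ℝ) : ℂ) * (((‖v₁ y‖ ^ (σ - 1) : ℝ) : ℂ) * v₁ y))
    (f := fun y => u₁ y - u₂ y) (hmu₁.sub hmu₂).aestronglyMeasurable hVm hVm (by positivity) hs0 hr0 hσ1 hexp2
    (fun y => by
      have hle : ‖v₁ y‖ ≤ V y := by simp [hV]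
      simp only [hVn]
      rw [norm_mul, norm_mul, Complex.norm_real, Complex.norm_real, NNReal.coe_one, one_mul,
        Real.norm_of_nonneg (Real.rpow_nonneg (norm_nonneg _) _), ← mul_assoc]
      gcongr)
  have e2 := eLpNorm_le_mul_rpow_mul (c := c) (p := r / (r - 1))
    (F := fun y => (u₂ y : ℂ) * (((‖v₁ y‖ ^ (σ - 1) : ℝ) : ℂ) * v₁ y -
        ((‖v₂ y‖ ^ (σ - 1) : ℝ) : ℂ) * v₂ y))
    hmu₂.aestronglyMeasurable hVm hwm (by positivity) hs0 hr0 hσ1 hexp2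
    (fun y => by
      simp only [hVn]
      rw [norm_mul, Complex.norm_real, hcσ]
      refine (mul_le_mul_of_nonneg_left (norm_rpow_mul_sub_rpow_mul_le hσ)
        (norm_nonneg _)).trans (le_of_eq ?_)
      ring)
  have hAσ : A ^ (2 * σ) = A * A ^ (σ - 1) * (A ^ (σ - 1) * A) := by
    have h : A ^ (σ - 1) * A = A ^ σ := by
      conv_rhs => rw [← sub_add_cancel σ 1, ENNReal.rpow_add_of_nonneg _ _ hσ1 zero_le_one,
        ENNReal.rpow_one]
    rw [mul_comm A, h, two_mul, ENNReal.rpow_add_of_nonneg _ _ (by linarith) (by linarith)]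
  calc _ ≤ 1 * (C * (c * A * A ^ (σ - 1) * D)) * A ^ (σ - 1) * A +
        c * (C * (A * A ^ (σ - 1) * A)) * A ^ (σ - 1) * D := by
        refine add_le_add (e1.trans ?_) (e2.trans ?_)
        · rw [ENNReal.coe_one]
          gcongr
        · gcongr
    _ = _ := by
        rw [hAσ]
        push_cast
        ring

/-- A form of the integral inequality of Minkowski. -/
lemma eLpNorm_integral_le_mul_lintegral {T X E : Type*} [MeasurableSpace T] [MeasurableSpace X]
    {ν : Measure T} {μ : Measure X} [SFinite ν] [SFinite μ] [NormedAddCommGroup E]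
    [NormedSpace ℝ E] {K : T → X → E}
    (hK : AEMeasurable (fun z : T × X => ‖K z.1 z.2‖ₑ) (ν.prod μ)) {w : T → ℝ≥0∞}
    (hw : Measurable w) (hw0 : ∀ᵐ τ ∂ν, w τ ≠ 0) (hwt : ∀ᵐ τ ∂ν, w τ ≠ ⊤)
    (hW : ∫⁻ τ, w τ ∂ν ≠ ⊤) {r : ℝ} (hr : 1 < r) {c : ℝ≥0}
    (hKw : ∀ᵐ τ ∂ν, eLpNorm (K τ) (ENNReal.ofReal r) μ ≤ c * w τ) :
    eLpNorm (fun x => ∫ τ, K τ x ∂ν) (ENNReal.ofReal r) μ ≤ c * ∫⁻ τ, w τ ∂ν := by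
  have hr0 : 0 < r := by linarith
  have hr1 : 0 < r - 1 := by linarith
  set W := ∫⁻ τ, w τ ∂ν with hWdef
  have hconj : r.HolderConjugate (r / (r - 1)) := Real.HolderConjugate.conjExponent hr
  have hWr : W ^ (r - 1) ≠ ⊤ := ENNReal.rpow_ne_top_of_nonneg hr1.le hW
  have hpt : ∀ᵐ x ∂μ, ‖∫ τ, K τ x ∂ν‖ₑ ^ r ≤
      (∫⁻ τ, ‖K τ x‖ₑ ^ r * w τ ^ (-(r - 1)) ∂ν) * W ^ (r - 1) := by
    have hKx : ∀ᵐ x ∂μ, AEMeasurable (fun τ => ‖K τ x‖ₑ) ν := by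
      have := (hK.comp_quasiMeasurePreserving
        (Measure.measurePreserving_swap (μ := μ) (ν := ν)).quasiMeasurePreserving)
      have h2 := this.aestronglyMeasurable.prodMk_left
      filter_upwards [h2] with x hx
      exact hx.aemeasurable
    filter_upwards [hKx] with x hx
    have h1 : ∫⁻ τ, ‖K τ x‖ₑ ∂ν ≤
        (∫⁻ τ, (‖K τ x‖ₑ * w τ ^ (-((r - 1) / r))) ^ r ∂ν) ^ (1 / r) *
        (∫⁻ τ, (w τ ^ ((r - 1) / r)) ^ (r / (r - 1)) ∂ν) ^ (1 / (r / (r - 1))) := by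
      refine le_trans (le_of_eq ?_) (ENNReal.lintegral_mul_le_Lp_mul_Lq ν hconj
        (hx.mul (hw.pow_const _).aemeasurable) (hw.pow_const _).aemeasurable)
      refine lintegral_congr_ae ?_
      filter_upwards [hw0, hwt] with τ h0 ht
      simp only [Pi.mul_apply]
      rw [mul_assoc, ← ENNReal.rpow_add _ _ h0 ht, neg_add_cancel, ENNReal.rpow_zero, mul_one]
    have h2 : ∀ τ, (w τ ^ ((r - 1) / r)) ^ (r / (r - 1)) = w τ := fun τ => by
      rw [← ENNReal.rpow_mul, show (r - 1) / r * (r / (r - 1)) = 1 by field_simp,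
        ENNReal.rpow_one]
    have h3 : ∀ τ, (‖K τ x‖ₑ * w τ ^ (-((r - 1) / r))) ^ r =
        ‖K τ x‖ₑ ^ r * w τ ^ (-(r - 1)) := fun τ => by
      rw [ENNReal.mul_rpow_of_nonneg _ _ hr0.le, ← ENNReal.rpow_mul,
        show -((r - 1) / r) * r = -(r - 1) by field_simp]
    simp_rw [h2, h3] at h1
    calc _ ≤ (∫⁻ τ, ‖K τ x‖ₑ ∂ν) ^ r := by
          gcongr
          exact enorm_integral_le_lintegral_enorm _
      _ ≤ _ := ENNReal.rpow_le_rpow h1 hr0.le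
      _ = _ := by
          rw [ENNReal.mul_rpow_of_nonneg _ _ hr0.le, ← ENNReal.rpow_mul, ← ENNReal.rpow_mul,
            one_div_mul_cancel hr0.ne', ENNReal.rpow_one, one_div_div,
            div_mul_cancel₀ _ hr0.ne']
  rw [eLpNorm_ofReal_eq _ hr0]
  calc _ ≤ (((c : ℝ≥0∞) * W) ^ r) ^ (1 / r) := by
        gcongr
        calc _ ≤ ∫⁻ x, (∫⁻ τ, ‖K τ x‖ₑ ^ r * w τ ^ (-(r - 1)) ∂ν) * W ^ (r - 1) ∂μ :=
              lintegral_mono_ae hpt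
          _ = (∫⁻ x, ∫⁻ τ, ‖K τ x‖ₑ ^ r * w τ ^ (-(r - 1)) ∂ν ∂μ) * W ^ (r - 1) :=
              lintegral_mul_const' _ _ hWr
          _ = (∫⁻ τ, ∫⁻ x, ‖K τ x‖ₑ ^ r * w τ ^ (-(r - 1)) ∂μ ∂ν) * W ^ (r - 1) := by
              rw [lintegral_lintegral_swap]
              exact ((hK.pow_const r).mul
                ((hw.comp measurable_fst).pow_const _).aemeasurable).comp_quasiMeasurePreserving
                (Measure.measurePreserving_swap (μ := μ) (ν := ν)).quasiMeasurePreserving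
          _ ≤ (∫⁻ τ, (c : ℝ≥0∞) ^ r * w τ ∂ν) * W ^ (r - 1) := by
              gcongr ?_ * _
              refine lintegral_mono_ae ?_
              filter_upwards [hw0, hwt, hKw] with τ h0 ht h
              have hne : w τ ^ (-(r - 1)) ≠ ⊤ := by
                rw [Ne, ENNReal.rpow_eq_top_iff]
                simp [h0, ht]
              rw [lintegral_mul_const' _ _ hne]
              rw [eLpNorm_ofReal_eq _ hr0, one_div, ENNReal.rpow_inv_le_iff hr0] at h
              calc _ ≤ ((c : ℝ≥0∞) * w τ) ^ r * w τ ^ (-(r - 1)) := by gcongr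
                _ = (c : ℝ≥0∞) ^ r * w τ := by
                  rw [ENNReal.mul_rpow_of_nonneg _ _ hr0.le, mul_assoc,
                    ← ENNReal.rpow_add _ _ h0 ht, show r + -(r - 1) = 1 by ring,
                    ENNReal.rpow_one]
          _ = ((c : ℝ≥0∞) * W) ^ r := by
              rw [lintegral_const_mul' _ _ (ENNReal.rpow_ne_top_of_nonneg hr0.le
                ENNReal.coe_ne_top), ← hWdef, ENNReal.mul_rpow_of_nonneg _ _ hr0.le, mul_assoc]
              congr 1
              conv_rhs => rw [show r = 1 + (r - 1) by ring,
                ENNReal.rpow_add_of_nonneg _ _ zero_le_one hr1.le, ENNReal.rpow_one]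
    _ = _ := by
        rw [← ENNReal.rpow_mul, mul_one_div_cancel hr0.ne', ENNReal.rpow_one]

lemma lintegral_Ioc_rpow_neg {δ L : ℝ} (hδ : δ < 1) (hL : 0 ≤ L) :
    ∫⁻ x in Ioc 0 L, ENNReal.ofReal (x ^ (-δ)) = ENNReal.ofReal (L ^ (1 - δ) / (1 - δ)) := by
  have hi : IntervalIntegrable (fun x : ℝ => x ^ (-δ)) volume 0 L :=
    intervalIntegral.intervalIntegrable_rpow' (by linarith)
  rw [← ofReal_integral_eq_lintegral_ofReal ((intervalIntegrable_iff_integrableOn_Ioc_of_le hL).1 hi)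
    ((ae_restrict_iff' measurableSet_Ioc).2 (ae_of_all _ fun x hx =>
      Real.rpow_nonneg hx.1.le _)),
    ← intervalIntegral.integral_of_le hL, integral_rpow (Or.inl (by linarith)),
    Real.zero_rpow (by linarith), sub_zero, neg_add_eq_sub]

lemma lintegral_Ioc_abs_sub_rpow_neg_le {δ t₁ t₂ t : ℝ} (hδ0 : 0 < δ) (hδ : δ < 1)
    (ht : t ∈ Icc t₁ t₂) :
    ∫⁻ τ in Ioc t₁ t₂, ENNReal.ofReal (|t - τ| ^ (-δ)) ≤
      ENNReal.ofReal (2 / (1 - δ) * (t₂ - t₁) ^ (1 - δ)) := by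
  have hL : 0 ≤ t₂ - t₁ := by linarith [ht.1, ht.2]
  set F : ℝ → ℝ≥0∞ := (Ioc 0 (t₂ - t₁)).indicator fun x => ENNReal.ofReal (x ^ (-δ)) with hF
  have hFm : Measurable F := Measurable.indicator (by fun_prop) measurableSet_Ioc
  have hFint : ∫⁻ x, F x = ENNReal.ofReal ((t₂ - t₁) ^ (1 - δ) / (1 - δ)) := by
    rw [hF, lintegral_indicator measurableSet_Ioc, lintegral_Ioc_rpow_neg hδ hL]
  calc _ ≤ ∫⁻ τ in Ioc t₁ t₂, (F (t - τ) + F (τ - t)) := by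
        refine setLIntegral_mono (by fun_prop) fun τ hτ => ?_
        rcases lt_trichotomy τ t with h | h | h
        · rw [abs_of_pos (sub_pos.2 h)]
          refine le_trans (le_of_eq ?_) le_self_add
          rw [hF, Set.indicator_of_mem]
          exact ⟨sub_pos.2 h, by linarith [hτ.1, ht.2]⟩
        · rw [h, sub_self, abs_zero, Real.zero_rpow (by linarith)]
          simp
        · rw [abs_sub_comm, abs_of_pos (sub_pos.2 h)]
          refine le_trans (le_of_eq ?_) le_add_self
          rw [hF, Set.indicator_of_mem]
          exact ⟨sub_pos.2 h, by linarith [hτ.2, ht.1]⟩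
    _ ≤ ∫⁻ τ, (F (t - τ) + F (τ - t)) := setLIntegral_le_lintegral _ _
    _ = _ := by
        rw [lintegral_add_left (by fun_prop), lintegral_sub_left_eq_self,
          lintegral_sub_right_eq_self, hFint, ← two_mul,
          ← ENNReal.ofReal_ofNat, ← ENNReal.ofReal_mul zero_le_two]
        congr 1
        ring

lemma measurable_integral_mul_param {T X Y : Type*} [MeasurableSpace T] [MeasurableSpace X]
    [MeasurableSpace Y] {ν : Measure Y} [SFinite ν] {k : T × X → Y → ℂ} {f : T → Y → ℂ}
    (hk : Measurable (Function.uncurry k)) (hf : Measurable (Function.uncurry f)) :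
    Measurable fun z : T × X => ∫ y, k z y * f z.1 y ∂ν := by
  have h : Measurable (Function.uncurry fun (z : T × X) y => k z y * f z.1 y) :=
    hk.mul (hf.comp ((measurable_fst.comp measurable_fst).prodMk measurable_snd))
  exact (h.stronglyMeasurable.integral_prod_right).measurable

lemma measurable_fourier_param {T : Type*} [MeasurableSpace T] {N : ℕ}
    {f : T → EuclideanSpace ℝ (Fin N) → ℂ} (hf : Measurable (Function.uncurry f)) :
    Measurable fun z : T × EuclideanSpace ℝ (Fin N) => 𝓕 (f z.1) z.2 := by
  simp only [Real.fourier_eq, Circle.smul_def, smul_eq_mul]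
  refine measurable_integral_mul_param (k := fun z y => (𝐞 (-inner ℝ y z.2) : ℂ)) ?_ hf
  have h : Measurable fun p : (T × EuclideanSpace ℝ (Fin N)) × EuclideanSpace ℝ (Fin N) =>
      -inner ℝ p.2 p.1.2 := by fun_prop
  exact (continuous_subtype_val.comp Real.continuous_fourierChar).measurable.comp h

lemma measurable_fourierInv_param {T : Type*} [MeasurableSpace T] {N : ℕ}
    {f : T → EuclideanSpace ℝ (Fin N) → ℂ} (hf : Measurable (Function.uncurry f)) :
    Measurable fun z : T × EuclideanSpace ℝ (Fin N) => 𝓕⁻ (f z.1) z.2 := by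
  simp only [Real.fourierInv_eq, Circle.smul_def, smul_eq_mul]
  refine measurable_integral_mul_param (k := fun z y => (𝐞 (inner ℝ y z.2) : ℂ)) ?_ hf
  have h : Measurable fun p : (T × EuclideanSpace ℝ (Fin N)) × EuclideanSpace ℝ (Fin N) =>
      inner ℝ p.2 p.1.2 := by fun_prop
  exact (continuous_subtype_val.comp Real.continuous_fourierChar).measurable.comp h

lemma measurable_schrodingerProp_param {N : ℕ} (t : ℝ) {f : ℝ → EuclideanSpace ℝ (Fin N) → ℂ}
    (hf : Measurable (Function.uncurry f)) :
    Measurable fun z : ℝ × EuclideanSpace ℝ (Fin N) => schrodingerProp N (t - z.1) (f z.1) z.2 := by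
  unfold schrodingerProp
  refine Measurable.ite ?_ hf ?_
  · exact (measurableSet_singleton 0).preimage (measurable_const.sub measurable_fst)
  · refine Measurable.mul ?_ ?_
    · fun_prop
    · exact measurable_integral_mul_param
        (k := fun z y => Complex.exp (Complex.I * ((‖z.2 - y‖ ^ 2 / (4 * (t - z.1)) : ℝ) : ℂ)))
        (by unfold Function.uncurry; fun_prop) hf

lemma continuous_uncurry_schwartzMap {T : Type*} [TopologicalSpace T] {N : ℕ}
    {v : T → SchwartzMap (EuclideanSpace ℝ (Fin N)) ℂ} (hv : Continuous v) :
    Continuous (Function.uncurry fun τ y => v τ y) := by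
  have h : Continuous fun τ => SchwartzMap.toBoundedContinuousFunctionCLM ℂ
      (EuclideanSpace ℝ (Fin N)) ℂ (v τ) :=
    (SchwartzMap.toBoundedContinuousFunctionCLM ℂ _ ℂ).continuous.comp hv
  exact (h.comp continuous_fst).eval continuous_snd

lemma measurable_nonlinearity_param {N : ℕ} {α σ : ℝ}
    {v : ℝ → SchwartzMap (EuclideanSpace ℝ (Fin N)) ℂ}
    {u : ℝ → SchwartzMap (EuclideanSpace ℝ (Fin N)) ℝ} (hv : Continuous v)
    (hu : ∀ τ x, u τ x - α ^ 2 * lap N (u τ) x = ‖v τ x‖ ^ (σ + 1)) :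
    Measurable (Function.uncurry fun τ y =>
      (u τ y : ℂ) * ((‖v τ y‖ ^ (σ - 1) : ℝ) : ℂ) * v τ y) := by
  have hvm := (continuous_uncurry_schwartzMap hv).measurable
  have hrhs : Measurable (Function.uncurry fun τ y => ((‖v τ y‖ ^ (σ + 1) : ℝ) : ℂ)) :=
    Complex.measurable_ofReal.comp (hvm.norm.pow_const _)
  have hum : Measurable (Function.uncurry fun τ y => (u τ y : ℂ)) := by
    have h1 : (Function.uncurry fun τ y => (u τ y : ℂ)) =
        fun z : ℝ × EuclideanSpace ℝ (Fin N) =>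
          𝓕⁻ (fun ξ => (((1 + α ^ 2 * (2 * π * ‖ξ‖) ^ 2)⁻¹ : ℝ) : ℂ) *
            𝓕 (fun y => ((‖v z.1 y‖ ^ (σ + 1) : ℝ) : ℂ)) ξ) z.2 := by
      ext z
      rw [Function.uncurry, postcompCLM_ofReal_eq_fourierInv α (u z.1) z.2]
      simp_rw [hu]
    rw [h1]
    refine measurable_fourierInv_param (f := fun τ ξ =>
      (((1 + α ^ 2 * (2 * π * ‖ξ‖) ^ 2)⁻¹ : ℝ) : ℂ) *
            𝓕 (fun y => ((‖v τ y‖ ^ (σ + 1) : ℝ) : ℂ)) ξ) ?_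
    exact (by fun_prop : Measurable fun z : ℝ × EuclideanSpace ℝ (Fin N) =>
      (((1 + α ^ 2 * (2 * π * ‖z.2‖) ^ 2)⁻¹ : ℝ) : ℂ)).mul (measurable_fourier_param hrhs)
  exact (hum.mul (Complex.measurable_ofReal.comp (hvm.norm.pow_const _))).mul hvm

lemma exists_sobolev_exponents {N : ℕ} (hN : 1 ≤ N) {σ : ℝ} (hσ : 1 ≤ σ)
    (hσ' : 2 < N → σ < 4 / ((N : ℝ) - 2)) :
    ∃ s r : ℝ, 2 < s ∧ (N : ℝ) * (s - 2) < 2 * s ∧ 2 < r ∧ (N : ℝ) * (r - 2) < 2 * r ∧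
      1 / s + (σ + 1) / r = 1 := by
  have hN1 : (1 : ℝ) ≤ N := by exact_mod_cast hN
  obtain ⟨x, hx0, hx2, hxN, hxσ⟩ : ∃ x : ℝ, 0 < x ∧ x < 1 / 2 ∧ (N : ℝ) * (1 - 2 * x) < 2 ∧
      ((N : ℝ) - 2) * (σ + 1) < 2 * N * (1 - x) := by
    rcases le_or_gt N 2 with h | h
    · have h2 : (N : ℝ) ≤ 2 := by exact_mod_cast h
      refine ⟨1 / 3, by norm_num, by norm_num, by linarith, ?_⟩
      nlinarith
    · have h2 : (2 : ℝ) < N := by exact_mod_cast h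
      have hσN : σ * ((N : ℝ) - 2) < 4 := (lt_div_iff₀ (by linarith)).1 (hσ' h)
      have h1 : ((N : ℝ) - 2) / (2 * N) < min (1 / 2) (1 - ((N : ℝ) - 2) * (σ + 1) / (2 * N)) := by
        refine lt_min ?_ ?_
        · rw [div_lt_iff₀ (by linarith)]
          linarith
        · rw [lt_sub_iff_add_lt, ← add_div, div_lt_one (by linarith)]
          linarith
      obtain ⟨x, hx, hx'⟩ := exists_between h1
      have hx2 := hx'.trans_le (min_le_right _ _)
      rw [div_lt_iff₀ (by linarith)] at hx
      rw [lt_sub_comm, div_lt_iff₀ (by linarith)] at hx2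
      exact ⟨x, by nlinarith, hx'.trans_le (min_le_left _ _), by linarith, by linarith⟩
  have hx1 : 0 < 1 - x := by linarith
  refine ⟨1 / x, (σ + 1) / (1 - x), ?_, ?_, ?_, ?_, ?_⟩
  · rwa [lt_div_iff₀ hx0, ← lt_div_iff₀' two_pos]
  · rw [div_sub' hx0.ne', mul_div_assoc', mul_div_assoc', div_lt_div_iff_of_pos_right hx0]
    linarith
  · rw [lt_div_iff₀ hx1]
    linarith
  · rw [div_sub' hx1.ne', mul_div_assoc', mul_div_assoc', div_lt_div_iff_of_pos_right hx1]
    linarith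
  · have : σ + 1 ≠ 0 := by linarith
    field_simp
    ring

lemma eLpNorm_le_of_H1norm_le {N : ℕ} {v : SchwartzMap (EuclideanSpace ℝ (Fin N)) ℂ} {M : ℝ}
    (hM : H1norm N (fun y => v y) ≤ M) :
    eLpNorm v 2 volume ≤ ENNReal.ofReal M ∧
      eLpNorm (fun x => fderiv ℝ v x) 2 volume ≤ ENNReal.ofReal M := by
  rw [H1norm] at hM
  have h1 : LpN N (fun y => v y) 2 ≤ M := by
    refine le_trans (Real.le_sqrt_of_sq_le ?_) hM
    exact le_add_of_nonneg_right (sq_nonneg _)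
  have h2 : gradL2 N (fun y => v y) ≤ M := by
    refine le_trans (Real.le_sqrt_of_sq_le ?_) hM
    exact le_add_of_nonneg_left (sq_nonneg _)
  rw [gradL2] at h2
  have h3 : eLpNorm (fun x => fderiv ℝ v x) 2 volume ≠ ⊤ := by
    have h := ((SchwartzMap.fderivCLM ℝ (EuclideanSpace ℝ (Fin N)) ℂ v).memLp 2
      volume).eLpNorm_ne_top
    have h' : ⇑(SchwartzMap.fderivCLM ℝ (EuclideanSpace ℝ (Fin N)) ℂ v) =
      fun x => fderiv ℝ v x := funext fun x => SchwartzMap.fderivCLM_apply ℝ v x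
    rwa [h'] at h
  rw [LpN, ENNReal.ofReal_ofNat] at h1
  have h4 : eLpNorm v 2 volume ≠ ⊤ := (v.memLp 2 volume).eLpNorm_ne_top
  have hM0 : 0 ≤ M := ENNReal.toReal_nonneg.trans h1
  constructor
  · rwa [ENNReal.le_ofReal_iff_toReal_le h4 hM0]
  · rwa [ENNReal.le_ofReal_iff_toReal_le h3 hM0]

lemma integrable_nonlinearity {N : ℕ} {σ : ℝ} (hσ : 1 ≤ σ)
    (v : SchwartzMap (EuclideanSpace ℝ (Fin N)) ℂ) (u : SchwartzMap (EuclideanSpace ℝ (Fin N)) ℝ) :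
    Integrable fun y => (u y : ℂ) * ((‖v y‖ ^ (σ - 1) : ℝ) : ℂ) * v y := by
  have hv : ∀ y, ‖v y‖ ≤ ‖v.toBoundedContinuousFunction‖ := fun y =>
    v.toBoundedContinuousFunction.norm_coe_le_norm y
  have hm : Measurable fun y => ((‖v y‖ ^ (σ - 1) : ℝ) : ℂ) * v y :=
    (Complex.measurable_ofReal.comp (v.continuous.measurable.norm.pow_const _)).mul
      v.continuous.measurable
  simp_rw [mul_assoc]
  refine u.integrable.ofReal.mul_bdd (c := ‖v.toBoundedContinuousFunction‖ ^ (σ - 1) *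
    ‖v.toBoundedContinuousFunction‖) hm.aestronglyMeasurable (.of_forall fun y => ?_)
  rw [norm_mul, Complex.norm_real, Real.norm_of_nonneg (by positivity)]
  exact mul_le_mul (Real.rpow_le_rpow (norm_nonneg _) (hv y) (by linarith)) (hv y)
    (norm_nonneg _) (by positivity)

lemma exists_eLpNorm_duhamel_sub_le {N : ℕ} (hN1 : 1 ≤ N) {α s σ r : ℝ} (hα : 0 < α)
    (hs : 2 < s) (hN : (N : ℝ) * (s - 2) < 2 * s) (hσ : 1 ≤ σ) (hr : 2 < r)
    (hrs : 1 / s + (σ + 1) / r = 1) (hNr : (N : ℝ) * (r - 2) < 2 * r) :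
    ∃ C : ℝ≥0, 0 < C ∧ ∀ (v₁ v₂ : ℝ → SchwartzMap (EuclideanSpace ℝ (Fin N)) ℂ)
      (u₁ u₂ : ℝ → SchwartzMap (EuclideanSpace ℝ (Fin N)) ℝ), Continuous v₁ → Continuous v₂ →
      (∀ τ x, u₁ τ x - α ^ 2 * lap N (u₁ τ) x = ‖v₁ τ x‖ ^ (σ + 1)) →
      (∀ τ x, u₂ τ x - α ^ 2 * lap N (u₂ τ) x = ‖v₂ τ x‖ ^ (σ + 1)) →
      ∀ t₁ t₂ : ℝ, t₁ ≤ t₂ → ∀ t ∈ Icc t₁ t₂, ∀ A B : ℝ≥0,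
      (∀ τ, eLpNorm (v₁ τ) (ENNReal.ofReal r) volume +
        eLpNorm (v₂ τ) (ENNReal.ofReal r) volume ≤ A) →
      (∀ τ, eLpNorm (fun x => v₁ τ x - v₂ τ x) (ENNReal.ofReal r) volume ≤ B) →
      eLpNorm (fun x => ∫ τ in t₁..t₂, schrodingerProp N (t - τ)
          (fun y => (u₁ τ y : ℂ) * ((‖v₁ τ y‖ ^ (σ - 1) : ℝ) : ℂ) * v₁ τ y
            - (u₂ τ y : ℂ) * ((‖v₂ τ y‖ ^ (σ - 1) : ℝ) : ℂ) * v₂ τ y) x)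
        (ENNReal.ofReal r) volume ≤
      ENNReal.ofReal ((4 * π) ^ ((N : ℝ) / r - (N : ℝ) / 2) * C * A ^ (2 * σ) * B *
        (t₂ - t₁) ^ ((N : ℝ) / r - (N : ℝ) / 2 + 1)) := by
  obtain ⟨D, hD, HD⟩ := exists_eLpNorm_schrodingerProp_le hr
  obtain ⟨L, hL, HL⟩ := exists_eLpNorm_nonlinearity_sub_le hα hs hN hσ hr hrs
  have hr0 : 0 < r := by linarith
  have hN0 : (0 : ℝ) < N := by exact_mod_cast hN1
  set δ : ℝ := (N : ℝ) / 2 - (N : ℝ) / r with hδ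
  have hδ0 : 0 < δ := sub_pos.2 (div_lt_div_of_pos_left hN0 two_pos hr)
  have hδ1 : δ < 1 := by
    rw [hδ, div_sub_div _ _ two_ne_zero hr0.ne', div_lt_one (by positivity)]
    linarith
  have hδ' : (N : ℝ) / r - (N : ℝ) / 2 = -δ := by rw [hδ]; ring
  have hδ2 : (0 : ℝ) < 2 / (1 - δ) := div_pos two_pos (by linarith)
  refine ⟨D * L * (2 / (1 - δ)).toNNReal, by
    have := Real.toNNReal_pos.2 hδ2
    positivity, fun v₁ v₂ u₁ u₂ hv₁ hv₂ hu₁ hu₂ t₁ t₂ ht₁₂ t ht A B hA hB => ?_⟩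
  set F : ℝ → EuclideanSpace ℝ (Fin N) → ℂ := fun τ y =>
    (u₁ τ y : ℂ) * ((‖v₁ τ y‖ ^ (σ - 1) : ℝ) : ℂ) * v₁ τ y
      - (u₂ τ y : ℂ) * ((‖v₂ τ y‖ ^ (σ - 1) : ℝ) : ℂ) * v₂ τ y with hF
  have hFm : Measurable (Function.uncurry F) :=
    (measurable_nonlinearity_param hv₁ hu₁).sub (measurable_nonlinearity_param hv₂ hu₂)
  have hFi : ∀ τ, Integrable (F τ) := fun τ =>
    (integrable_nonlinearity hσ (v₁ τ) (u₁ τ)).sub (integrable_nonlinearity hσ (v₂ τ) (u₂ τ))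
  have hne : ∀ᵐ τ ∂(volume.restrict (Ioc t₁ t₂)), t - τ ≠ 0 := by
    refine ae_restrict_of_ae ?_
    have h : ∀ᵐ τ : ℝ, τ ≠ t := by simp [ae_iff]
    filter_upwards [h] with τ hτ
    exact sub_ne_zero.2 hτ.symm
  have hW := lintegral_Ioc_abs_sub_rpow_neg_le hδ0 hδ1 ht
  have h2σ : 0 ≤ 2 * σ := by linarith
  have h4 : 0 ≤ (4 * π) ^ (-δ) := by positivity
  set c : ℝ≥0 := ((4 * π) ^ (-δ)).toNNReal * D * L * A ^ (2 * σ) * B with hc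
  have key := eLpNorm_integral_le_mul_lintegral (ν := volume.restrict (Ioc t₁ t₂))
    (μ := (volume : Measure (EuclideanSpace ℝ (Fin N))))
    (K := fun τ x => schrodingerProp N (t - τ) (F τ) x)
    (measurable_schrodingerProp_param t hFm).enorm.aemeasurable
    (w := fun τ => ENNReal.ofReal (|t - τ| ^ (-δ))) (by fun_prop)
    (by
      filter_upwards [hne] with τ hτ
      have := abs_pos.2 hτ
      exact (ENNReal.ofReal_pos.2 (by positivity)).ne')
    (.of_forall fun _ => ENNReal.ofReal_ne_top) (hW.trans_lt ENNReal.ofReal_lt_top).ne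
    (r := r) (by linarith) (c := c) (by
      filter_upwards [hne] with τ hτ
      refine (HD (hFi τ) hτ).trans ?_
      have hnl : eLpNorm (F τ) (ENNReal.ofReal (r / (r - 1))) volume ≤ L * A ^ (2 * σ) * B := by
        refine (HL (v₁ τ) (v₂ τ) (u₁ τ) (u₂ τ) (hu₁ τ) (hu₂ τ)).trans ?_
        gcongr
        · exact hA τ
        · exact hB τ
      rw [hδ', Real.mul_rpow (by positivity) (abs_nonneg _), ENNReal.ofReal_mul h4, hc]
      push_cast
      rw [ENNReal.coe_rpow_of_nonneg A h2σ]
      calc _ ≤ ENNReal.ofReal ((4 * π) ^ (-δ)) * ENNReal.ofReal (|t - τ| ^ (-δ)) *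
            (D * (L * A ^ (2 * σ) * B)) := by gcongr
        _ = _ := by
          rw [ENNReal.ofReal]
          ring)
  simp_rw [intervalIntegral.integral_of_le ht₁₂]
  refine key.trans ((mul_le_mul_right hW _).trans_eq ?_)
  rw [← ENNReal.ofReal_coe_nnreal, ← ENNReal.ofReal_mul c.coe_nonneg, hδ', hc]
  congr 1
  push_cast
  rw [Real.coe_toNNReal _ h4, Real.coe_toNNReal _ hδ2.le, neg_add_eq_sub]
  ring

end

/-- (Lemma 7) estimate for the Duhamel-type operator
`G(t₁,t₂)v(t) = ∫_{t₁}^{t₂} U(t-τ) f(v(τ)) dτ` with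
`f(v) = u|v|^{σ-1}v`, `u - α²Δu = |v|^{σ+1}`:
`‖G(t₁,t₂)v₁(t) - G(t₁,t₂)v₂(t)‖_r ≤ k' sup_J ‖v₁-v₂‖_r (t₂-t₁)^{N/r-N/2+1}`. -/
theorem stmt14 (N : ℕ) (hN : 1 ≤ N) (α : ℝ) (hα : 0 < α) (σ : ℝ) (hσ : 1 ≤ σ)
    (hσ' : 2 < N → σ < 4 / ((N : ℝ) - 2)) :
    ∃ r r' : ℝ, 2 < r ∧ (2 < N → r ≤ 2 * N / ((N : ℝ) - 2)) ∧
      0 < (N : ℝ) / r - (N : ℝ) / 2 + 1 ∧ 1 / r + 1 / r' = 1 ∧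
      ∃ C : ℝ, 0 < C ∧
        ∀ (a b : ℝ), a ≤ b → ∀ (M : ℝ), 0 < M →
        ∀ (v₁ v₂ : ℝ → SchwartzMap (EuclideanSpace ℝ (Fin N)) ℂ)
          (u₁ u₂ : ℝ → SchwartzMap (EuclideanSpace ℝ (Fin N)) ℝ),
          ContinuousOn (fun τ => v₁ τ) (Set.Icc a b) →
          ContinuousOn (fun τ => v₂ τ) (Set.Icc a b) →
          (∀ τ ∈ Set.Icc a b, H1norm N (fun y => v₁ τ y) ≤ M) →
          (∀ τ ∈ Set.Icc a b, H1norm N (fun y => v₂ τ y) ≤ M) →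
          (∀ τ ∈ Set.Icc a b, ∀ x,
            u₁ τ x - α ^ 2 * lap N (fun y => u₁ τ y) x = ‖v₁ τ x‖ ^ (σ + 1)) →
          (∀ τ ∈ Set.Icc a b, ∀ x,
            u₂ τ x - α ^ 2 * lap N (fun y => u₂ τ y) x = ‖v₂ τ x‖ ^ (σ + 1)) →
          ∀ t₁ t₂ : ℝ, a ≤ t₁ → t₁ ≤ t₂ → t₂ ≤ b →
          ∀ t ∈ Set.Icc t₁ t₂,
            LpN N (fun x => ∫ τ in t₁..t₂, schrodingerProp N (t - τ)
                (fun y =>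
                  (u₁ τ y : ℂ) * ((‖v₁ τ y‖ ^ (σ - 1) : ℝ) : ℂ) * v₁ τ y
                    - (u₂ τ y : ℂ) * ((‖v₂ τ y‖ ^ (σ - 1) : ℝ) : ℂ) * v₂ τ y) x) r
              ≤ (4 * Real.pi) ^ ((N : ℝ) / r - (N : ℝ) / 2) * C * (2 * M) ^ (2 * σ) *
                  (⨆ τ ∈ Set.Icc a b, LpN N (fun x => v₁ τ x - v₂ τ x) r) *
                  (t₂ - t₁) ^ ((N : ℝ) / r - (N : ℝ) / 2 + 1) := by
  obtain ⟨s, r, hs, hNs, hr, hNr, hsr⟩ := exists_sobolev_exponents hN hσ hσ'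
  have hr0 : 0 < r := by linarith
  have hr1 : r - 1 ≠ 0 := by linarith
  obtain ⟨S, hS, HS⟩ := exists_eLpNorm_le_sobolev (N := N) hr hNr
  obtain ⟨C, hC, HC⟩ := exists_eLpNorm_duhamel_sub_le hN hα hs hNs hσ hr hsr hNr
  refine ⟨r, r / (r - 1), hr, fun h => ?_, ?_, ?_, C * (2 * S) ^ (2 * σ), by positivity, ?_⟩
  · have h2 : (2 : ℝ) < N := by exact_mod_cast h
    rw [le_div_iff₀ (by linarith)]
    linarith
  · rw [div_sub_div _ _ hr0.ne' two_ne_zero, ← neg_lt_iff_pos_add, lt_div_iff₀ (by positivity)]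
    linarith
  · field_simp
    ring
  intro a b hab M hM v₁ v₂ u₁ u₂ hv₁ hv₂ hM₁ hM₂ hu₁ hu₂ t₁ t₂ ht₁ ht₁₂ ht₂ t ht
  have hbound : ∀ v : SchwartzMap (EuclideanSpace ℝ (Fin N)) ℂ, H1norm N (fun y => v y) ≤ M →
      eLpNorm v (ENNReal.ofReal r) volume ≤ ((2 * S * M.toNNReal : ℝ≥0) : ℝ≥0∞) := fun v hv => by
    obtain ⟨h1, h2⟩ := eLpNorm_le_of_H1norm_le hv
    calc _ ≤ S * (ENNReal.ofReal M + ENNReal.ofReal M) := (HS v).trans (by gcongr)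
      _ = _ := by
        rw [ENNReal.ofReal]
        push_cast
        ring
  have hsum : ∀ τ ∈ Icc a b, eLpNorm (v₁ τ) (ENNReal.ofReal r) volume +
      eLpNorm (v₂ τ) (ENNReal.ofReal r) volume ≤ ((2 * S * (2 * M.toNNReal) : ℝ≥0) : ℝ≥0∞) :=
    fun τ hτ => (add_le_add (hbound _ (hM₁ τ hτ)) (hbound _ (hM₂ τ hτ))).trans_eq (by
      rw [← ENNReal.coe_add]
      congr 1
      ring)
  have hdiff : ∀ τ ∈ Icc a b, eLpNorm (fun x => v₁ τ x - v₂ τ x) (ENNReal.ofReal r) volume ≤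
      ((2 * S * (2 * M.toNNReal) : ℝ≥0) : ℝ≥0∞) := fun τ hτ =>
    (eLpNorm_sub_le (v₁ τ).continuous.aestronglyMeasurable (v₂ τ).continuous.aestronglyMeasurable
      (by rw [← ENNReal.ofReal_one]; exact ENNReal.ofReal_le_ofReal (by linarith))).trans
      (hsum τ hτ)
  set B : ℝ := ⨆ τ ∈ Set.Icc a b, LpN N (fun x => v₁ τ x - v₂ τ x) r with hB
  have hB0 : 0 ≤ B := Real.iSup_nonneg fun τ => Real.iSup_nonneg fun _ => ENNReal.toReal_nonneg
  have hBle : ∀ τ ∈ Icc a b, LpN N (fun x => v₁ τ x - v₂ τ x) r ≤ B := fun τ hτ => by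
    have hbdd : BddAbove (range fun τ => ⨆ _ : τ ∈ Set.Icc a b,
        LpN N (fun x => v₁ τ x - v₂ τ x) r) := by
      refine ⟨((2 * S * (2 * M.toNNReal) : ℝ≥0) : ℝ), ?_⟩
      rintro _ ⟨τ, rfl⟩
      refine Real.iSup_le (fun hτ => ?_) (NNReal.coe_nonneg _)
      exact ENNReal.toReal_le_of_le_ofReal (NNReal.coe_nonneg _)
        ((hdiff τ hτ).trans_eq (ENNReal.ofReal_coe_nnreal).symm)
    refine le_trans ?_ (le_ciSup hbdd τ)
    simp [hτ]
  have hBle' : ∀ τ ∈ Icc a b, eLpNorm (fun x => v₁ τ x - v₂ τ x) (ENNReal.ofReal r) volume ≤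
      B.toNNReal := fun τ hτ =>
    (ENNReal.le_ofReal_iff_toReal_le ((hdiff τ hτ).trans_lt ENNReal.coe_lt_top).ne hB0).2
      (hBle τ hτ)
  have hp : ∀ τ, (projIcc a b hab τ : ℝ) ∈ Icc a b := fun τ => (projIcc a b hab τ).2
  have hmain := HC (fun τ => v₁ (projIcc a b hab τ)) (fun τ => v₂ (projIcc a b hab τ))
    (fun τ => u₁ (projIcc a b hab τ)) (fun τ => u₂ (projIcc a b hab τ))
    ((continuousOn_iff_continuous_domRestrict.1 hv₁).comp continuous_projIcc)
    ((continuousOn_iff_continuous_domRestrict.1 hv₂).comp continuous_projIcc)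
    (fun τ => hu₁ _ (hp τ)) (fun τ => hu₂ _ (hp τ)) t₁ t₂ ht₁₂ t ht _ _
    (fun τ => hsum _ (hp τ)) (fun τ => hBle' _ (hp τ))
  have heq : ∀ x, ∫ τ in t₁..t₂, schrodingerProp N (t - τ)
        (fun y => (u₁ τ y : ℂ) * ((‖v₁ τ y‖ ^ (σ - 1) : ℝ) : ℂ) * v₁ τ y
          - (u₂ τ y : ℂ) * ((‖v₂ τ y‖ ^ (σ - 1) : ℝ) : ℂ) * v₂ τ y) x =
      ∫ τ in t₁..t₂, schrodingerProp N (t - τ)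
        (fun y => (u₁ (projIcc a b hab τ) y : ℂ) *
            ((‖v₁ (projIcc a b hab τ) y‖ ^ (σ - 1) : ℝ) : ℂ) * v₁ (projIcc a b hab τ) y
          - (u₂ (projIcc a b hab τ) y : ℂ) *
            ((‖v₂ (projIcc a b hab τ) y‖ ^ (σ - 1) : ℝ) : ℂ) * v₂ (projIcc a b hab τ) y) x :=
    fun x => intervalIntegral.integral_congr fun τ hτ => by
      rw [uIcc_of_le ht₁₂] at hτ
      have hτ' : (projIcc a b hab τ : ℝ) = τ := by
        rw [projIcc_of_mem hab ⟨ht₁.trans hτ.1, hτ.2.trans ht₂⟩]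
      simp only [hτ']
  have ht0 : 0 ≤ t₂ - t₁ := sub_nonneg.2 ht₁₂
  simp_rw [heq]
  refine (ENNReal.toReal_le_of_le_ofReal (by positivity) hmain).trans_eq ?_
  push_cast
  rw [Real.coe_toNNReal _ hM.le, Real.coe_toNNReal _ hB0,
    Real.mul_rpow (by positivity) (by positivity : 0 ≤ 2 * M)]
  ring
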